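/- There exists a constant c > 0 such that for every finite abelian group G with |G| ≥ 2, any skew-corner-free subset A of G × G satisfies |A| ≤ exp(−c · (log|G|)^{1/12}) · |G|². -/

import Mathlib

open scoped BigOperators Classical

noncomputable section

namespace SkewPaper

variable {G : Type*}

/-- Expectation (average) of `f` over a finite type: `E[f] = (1/|G|) ∑ x, f x`. -/
def expect [Fintype G] (f : G → ℝ) : ℝ := (∑ x, f x) / (Fintype.card G)

/-- Normalized inner product `⟨f, g⟩ = E_{x∈G} f(x) g(x)`. -/
def inprod [Fintype G] (f g : G → ℝ) : ℝ := expect (fun x => f x * g x)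

/-- Convolution `(f ∗ g)(x) = E_{y∈G} f(y) g(x − y)`. -/
def conv [Fintype G] [AddCommGroup G] (f g : G → ℝ) : G → ℝ :=
  fun x => expect (fun y => f y * g (x - y))

/-- Difference convolution `(f ∘ g)(x) = E_{y∈G} f(y) g(x + y)`. -/
def dconv [Fintype G] [AddCommGroup G] (f g : G → ℝ) : G → ℝ :=
  fun x => expect (fun y => f y * g (x + y))

/-- Indicator function `1_A` of a set `A`. -/
def ind (A : Set G) : G → ℝ := Set.indicator A (fun _ => (1 : ℝ))

/-- Normalized indicator `μ_A = (|G|/|A|) · 1_A`. -/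
def muSet [Fintype G] (A : Set G) : G → ℝ :=
  fun x => ((Fintype.card G : ℝ) / (Nat.card A : ℝ)) * ind A x

/-- `μ_f = f / E[f]`, the normalization of `f` to have mean 1. -/
def muFun [Fintype G] (f : G → ℝ) : G → ℝ := fun x => f x / expect f

/-- Weighted `L^p` norm `‖f‖_{p(ν)} = (E_x ν(x) |f(x)|^p)^{1/p}`. -/
def wnorm [Fintype G] (p : ℕ) (ν f : G → ℝ) : ℝ :=
  (expect (fun x => ν x * |f x| ^ p)) ^ ((p : ℝ)⁻¹)

/-- `L^p` norm with respect to the uniform measure. -/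
def pnorm [Fintype G] (p : ℕ) (f : G → ℝ) : ℝ := wnorm p (fun _ => 1) f

/-- Sup norm `‖f‖_∞`. -/
def supNorm (f : G → ℝ) : ℝ := ⨆ x, |f x|

/-- `A` is skew-corner-free: it contains no nontrivial skew corner
`(x,y), (x,y+h), (x+h,y')` with `h ≠ 0`. -/
def IsSkewCornerFree [AddCommGroup G] (A : Set (G × G)) : Prop :=
  ∀ x y y' h : G, (x, y) ∈ A → (x, y + h) ∈ A → (x + h, y') ∈ A → h = 0

/-- The set of quadruples `(x, y, y', h)` forming a skew corner of `A`. -/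
def skewCorners [AddCommGroup G] (A : Set (G × G)) : Set (G × G × G × G) :=
  {q | (q.1, q.2.1) ∈ A ∧ (q.1, q.2.1 + q.2.2.2) ∈ A ∧ (q.1 + q.2.2.2, q.2.2.1) ∈ A}

/-- The column `A_x = {y : (x,y) ∈ A}`. -/
def col (A : Set (G × G)) (x : G) : Set G := {y | (x, y) ∈ A}

/-- A Bohr set datum: a finite frequency set of characters together with a width. -/
structure BohrSet (G : Type*) [AddCommGroup G] where
  freq : Finset (AddChar G ℂ)
  width : ℝ

namespace BohrSet

variable [AddCommGroup G]

/-- The underlying set `Bohr(Γ, φ) = {x : |1 − γ(x)| ≤ φ for all γ ∈ Γ}`. -/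
def toSet (B : BohrSet G) : Set G :=
  {x | ∀ γ ∈ B.freq, ‖(1 : ℂ) - γ x‖ ≤ B.width}

/-- The rank `|Γ|` of a Bohr set. -/
def rank (B : BohrSet G) : ℕ := B.freq.card

/-- The dilate `B_ρ = Bohr(Γ, ρφ)`. -/
def dilate (B : BohrSet G) (ρ : ℝ) : BohrSet G := ⟨B.freq, ρ * B.width⟩

/-- `B'` is a sub-Bohr set of `B` (written `B' ≤ B`): its frequency set contains
that of `B` and its width is at most that of `B`. -/
def Sub (B' B : BohrSet G) : Prop := B.freq ⊆ B'.freq ∧ B'.width ≤ B.width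

/-- A Bohr set of rank `r` is regular if for all `0 ≤ κ ≤ 1/(100r)`,
`|B_{1+κ}| ≤ (1+100κr)|B|` and `|B_{1−κ}| ≥ (1−100κr)|B|`. -/
def IsRegular (B : BohrSet G) : Prop :=
  ∀ κ : ℝ, 0 ≤ κ → κ ≤ 1 / (100 * B.rank) →
    ((Nat.card (B.dilate (1 + κ)).toSet : ℝ) ≤ (1 + 100 * κ * B.rank) * (Nat.card B.toSet : ℝ) ∧
     (Nat.card (B.dilate (1 - κ)).toSet : ℝ) ≥ (1 - 100 * κ * B.rank) * (Nat.card B.toSet : ℝ))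

/-- The density `μ(B) = |B|/|G|`. -/
def measure [Fintype G] (B : BohrSet G) : ℝ := (Nat.card B.toSet : ℝ) / (Fintype.card G : ℝ)

/-- The normalized indicator measure `μ_B`. -/
def mu [Fintype G] (B : BohrSet G) : G → ℝ := muSet B.toSet

end BohrSet


/-- (r, λ)-simultaneously spread collection of subsets of 𝔽_q^n. -/
def SimSpread {F : Type*} [Field F] [Fintype F] {n : ℕ} {ι : Type*} [Fintype ι]
    (A : ι → Set (Fin n → F)) (r : ℕ) (lam : ℝ) : Prop :=
  ∀ V : Submodule F (Fin n → F), n ≤ Module.finrank F V + r →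
    ∀ x : ι → Fin n → F,
      ∑ i, ((Nat.card ↥(((fun a => a - x i) '' A i) ∩ (V : Set (Fin n → F))) : ℝ) /
            (Nat.card (V : Set (Fin n → F)) : ℝ)) ^ 2 ≤
        lam * ∑ i, ((Nat.card (A i) : ℝ) / ((Fintype.card F : ℝ) ^ n)) ^ 2

/-- (r, λ)-simultaneously spread in an ambient subspace `W`. -/
def SimSpreadIn {F : Type*} [Field F] [Fintype F] {n : ℕ} {ι : Type*} [Fintype ι]
    (W : Submodule F (Fin n → F)) (A : ι → Set (Fin n → F)) (r : ℕ) (lam : ℝ) : Prop :=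
  ∀ V : Submodule F (Fin n → F), V ≤ W → Module.finrank F W ≤ Module.finrank F V + r →
    ∀ x : ι → Fin n → F, (∀ i, x i ∈ W) →
      ∑ i, ((Nat.card ↥(((fun a => a - x i) '' A i) ∩ (V : Set (Fin n → F))) : ℝ) /
            (Nat.card (V : Set (Fin n → F)) : ℝ)) ^ 2 ≤
        lam * ∑ i, ((Nat.card (A i) : ℝ) / (Nat.card (W : Set (Fin n → F)) : ℝ)) ^ 2

/-- (r, δ, λ)-simultaneously spread collection of subsets of a regular Bohr set `B`. -/
def SimSpreadBohr {G : Type*} [AddCommGroup G] [Fintype G] {ι : Type*} [Fintype ι]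
    (B : BohrSet G) (A : ι → Set G) (r : ℕ) (δ lam : ℝ) : Prop :=
  ∀ B' : BohrSet G, B'.Sub B → B'.IsRegular → B'.rank ≤ B.rank + r →
    δ * B.measure ≤ B'.measure →
    ∀ x : ι → G,
      ∑ i, ((Nat.card ↥(((fun a => a - x i) '' A i) ∩ B'.toSet) : ℝ) /
            (Nat.card B'.toSet : ℝ)) ^ 2 ≤
        lam * ∑ i, ((Nat.card (A i) : ℝ) / (Nat.card B.toSet : ℝ)) ^ 2

section Grid
variable {α β ω : Type*}

theorem expect_expect_eq_sum_div (A : Finset α) (f : α → α → ℝ) :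
    𝔼 s ∈ A, 𝔼 t ∈ A, f s t = (∑ s ∈ A, ∑ t ∈ A, f s t) / (A.card : ℝ) ^ 2 := by
  simp only [Finset.expect_eq_sum_div_card, ← Finset.sum_div, div_div]
  rw [sq]

theorem expect_grid_pow_eq (S : Finset α) (T : Finset β) (Ω : Finset ω)
    (φ : α → ω → ℝ) (ψ : β → ω → ℝ) (p : ℕ) :
    𝔼 s ∈ S, 𝔼 t ∈ T, (𝔼 w ∈ Ω, φ s w * ψ t w) ^ p =
      𝔼 f ∈ Fintype.piFinset (fun _ : Fin p => Ω),
        (𝔼 s ∈ S, ∏ i, φ s (f i)) * (𝔼 t ∈ T, ∏ i, ψ t (f i)) := by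
  simp_rw [Finset.expect_mul_expect, Finset.expect_pow, Finset.prod_mul_distrib]
  rw [Finset.expect_comm (s := Fintype.piFinset _)]
  exact Finset.expect_congr rfl fun s _ => Finset.expect_comm _ _ _

theorem expect_grid_pow_sq_le (S : Finset α) (T : Finset β) (Ω : Finset ω)
    (φ : α → ω → ℝ) (ψ : β → ω → ℝ) (p : ℕ) :
    (𝔼 s ∈ S, 𝔼 t ∈ T, (𝔼 w ∈ Ω, φ s w * ψ t w) ^ p) ^ 2 ≤
      (𝔼 s ∈ S, 𝔼 s' ∈ S, (𝔼 w ∈ Ω, φ s w * φ s' w) ^ p) *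
      (𝔼 t ∈ T, 𝔼 t' ∈ T, (𝔼 w ∈ Ω, ψ t w * ψ t' w) ^ p) := by
  simp_rw [expect_grid_pow_eq, ← sq]
  exact Finset.expect_mul_sq_le_sq_mul_sq _ _ _

theorem expect_grid_pow_nonneg (S : Finset α) (Ω : Finset ω) (φ : α → ω → ℝ) (p : ℕ) :
    0 ≤ 𝔼 s ∈ S, 𝔼 s' ∈ S, (𝔼 w ∈ Ω, φ s w * φ s' w) ^ p := by
  rw [expect_grid_pow_eq]
  exact Finset.expect_nonneg fun _ _ => mul_self_nonneg _

/-- If two families of functions are negatively correlated on many pairs, then one of them has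
large self-correlation in the grid norm. -/
theorem grid_large_of_neg_corr (X : Finset α) (Ω : Finset ω) (φ ψ : α → ω → ℝ)
    {p : ℕ} (hp : Even p) {m : ℝ} (hm : 0 < m) (hm1 : 1 ≤ (9 / 5 : ℝ) ^ p * (m / 2))
    (P : α → α → Prop) (hP : m / 2 ≤ 𝔼 s ∈ X, 𝔼 t ∈ X, if P s t then (1 : ℝ) else 0)
    (hneg : ∀ s ∈ X, ∀ t ∈ X, P s t → 𝔼 w ∈ Ω, φ s w * ψ t w ≤ -(9 / 10 * m)) :
    (m / 2) ^ p ≤ 𝔼 s ∈ X, 𝔼 s' ∈ X, (𝔼 w ∈ Ω, φ s w * φ s' w) ^ p ∨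
    (m / 2) ^ p ≤ 𝔼 s ∈ X, 𝔼 s' ∈ X, (𝔼 w ∈ Ω, ψ s w * ψ s' w) ^ p := by
  set I := 𝔼 s ∈ X, 𝔼 t ∈ X, (𝔼 w ∈ Ω, φ s w * ψ t w) ^ p with hI
  have h1 : (9 / 10 * m) ^ p * (m / 2) ≤ I := by
    calc (9 / 10 * m) ^ p * (m / 2)
        ≤ (9 / 10 * m) ^ p * 𝔼 s ∈ X, 𝔼 t ∈ X, if P s t then (1 : ℝ) else 0 := by gcongr
      _ = 𝔼 s ∈ X, 𝔼 t ∈ X, if P s t then (9 / 10 * m) ^ p else 0 := by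
          simp_rw [Finset.mul_expect, mul_ite, mul_one, mul_zero]
      _ ≤ I := by
          refine Finset.expect_le_expect fun s hs => Finset.expect_le_expect fun t ht => ?_
          split_ifs with h
          · have := hneg s hs t ht h
            rw [← Even.neg_pow hp (𝔼 w ∈ Ω, _)]
            exact pow_le_pow_left₀ (by positivity) (by linarith) _
          · exact hp.pow_nonneg _
  have h2 : (m / 2) ^ p ≤ I := by
    refine le_trans ?_ h1
    calc (m / 2) ^ p = (m / 2) ^ p * 1 := by ring
      _ ≤ (m / 2) ^ p * ((9 / 5 : ℝ) ^ p * (m / 2)) := by gcongr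
      _ = (9 / 10 * m) ^ p * (m / 2) := by rw [← mul_assoc, ← mul_pow]; congr 2; ring
  by_contra! h
  have h3 := expect_grid_pow_sq_le X X Ω φ ψ p
  have h4 := mul_lt_mul'' h.1 h.2 (expect_grid_pow_nonneg ..) (expect_grid_pow_nonneg ..)
  have h5 := mul_self_le_mul_self (by positivity) h2
  rw [sq] at h3
  linarith

theorem eight_pow_le_choose (p : ℕ) : 8 ^ p ≤ (8 * p).choose p := by
  rcases Nat.eq_zero_or_pos p with rfl | hp
  · simp
  refine Nat.le_of_mul_le_mul_right ?_ (Nat.factorial_pos p)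
  rw [mul_comm (Nat.choose _ _), ← Nat.descFactorial_eq_factorial_mul_choose,
    Nat.descFactorial_eq_prod_range, ← Nat.descFactorial_self p, Nat.descFactorial_eq_prod_range]
  have e : 8 ^ p = ∏ _i ∈ Finset.range p, 8 := by simp
  rw [e, ← Finset.prod_mul_distrib]
  refine Finset.prod_le_prod' fun i hi => ?_
  have := Finset.mem_range.1 hi
  omega

/-- Nonnegativity of all moments forces the moments of `1 + g / m` to be large. -/
theorem four_pow_le_expect_one_add (X : Finset α) (Ω : Finset ω) (φ : α → ω → ℝ)
    {p : ℕ} {m : ℝ} (hm : 0 < m)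
    (h : (m / 2) ^ p ≤ 𝔼 s ∈ X, 𝔼 s' ∈ X, (𝔼 w ∈ Ω, φ s w * φ s' w) ^ p) :
    4 ^ p ≤ 𝔼 s ∈ X, 𝔼 s' ∈ X, (1 + (𝔼 w ∈ Ω, φ s w * φ s' w) / m) ^ (8 * p) := by
  have e : ∀ s s', (1 + (𝔼 w ∈ Ω, φ s w * φ s' w) / m) ^ (8 * p) =
      ∑ j ∈ Finset.range (8 * p + 1), ((8 * p).choose j / m ^ j) *
        (𝔼 w ∈ Ω, φ s w * φ s' w) ^ j := by
    intro s s'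
    rw [add_comm, add_pow]
    refine Finset.sum_congr rfl fun j _ => ?_
    rw [one_pow, div_pow]
    ring
  simp_rw [e, Finset.expect_sum_comm, ← Finset.mul_expect]
  calc (4 : ℝ) ^ p = 8 ^ p / m ^ p * (m / 2) ^ p := by
        rw [← div_pow, ← mul_pow]; congr 1; field_simp; norm_num
    _ ≤ ((8 * p).choose p / m ^ p) * 𝔼 s ∈ X, 𝔼 s' ∈ X, (𝔼 w ∈ Ω, φ s w * φ s' w) ^ p := by
        have := eight_pow_le_choose p
        gcongr
        exact_mod_cast this
    _ ≤ _ := by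
        refine Finset.single_le_sum (f := fun j => ((8 * p).choose j / m ^ j) *
          𝔼 s ∈ X, 𝔼 s' ∈ X, (𝔼 w ∈ Ω, φ s w * φ s' w) ^ j) (fun j _ => ?_) ?_
        · exact mul_nonneg (by positivity) (expect_grid_pow_nonneg ..)
        · simp; omega

theorem expect_moment_lower_bound {X : Finset α} (hX : X.Nonempty) (Ω : Finset ω) (M φ : α → ω → ℝ)
    (hM : ∀ s w, 0 ≤ M s w) {p : ℕ} (hp : 2 ≤ p) {m : ℝ} (hm : 0 < m)
    (hn : ∀ s ∈ X, ∀ s' ∈ X,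
      |𝔼 w ∈ Ω, M s w * M s' w - (m + 𝔼 w ∈ Ω, φ s w * φ s' w)| ≤ m / 1000)
    (h : (m / 2) ^ p ≤ 𝔼 s ∈ X, 𝔼 s' ∈ X, (𝔼 w ∈ Ω, φ s w * φ s' w) ^ p) :
    (16 / 5) ^ p * m ^ (8 * p) ≤ 𝔼 s ∈ X, 𝔼 s' ∈ X, (𝔼 w ∈ Ω, M s w * M s' w) ^ (8 * p) := by
  have h4 := four_pow_le_expect_one_add X Ω φ hm h
  have hpt : ∀ s ∈ X, ∀ s' ∈ X, (1 + (𝔼 w ∈ Ω, φ s w * φ s' w) / m) ^ (8 * p) ≤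
      (101 / 100) ^ (8 * p) * ((𝔼 w ∈ Ω, M s w * M s' w) ^ (8 * p) / m ^ (8 * p)) + 1 := by
    intro s hs s' hs'
    have h1 := abs_le.1 (hn s hs s' hs')
    have h0 : 0 ≤ 𝔼 w ∈ Ω, M s w * M s' w :=
      Finset.expect_nonneg fun w _ => mul_nonneg (hM _ _) (hM _ _)
    set n := 𝔼 w ∈ Ω, M s w * M s' w
    set g := 𝔼 w ∈ Ω, φ s w * φ s' w
    have e8 : Even (8 * p) := ⟨4 * p, by ring⟩
    rw [← e8.pow_abs, ← div_pow, ← mul_pow]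
    have hg : 1 + g / m = (m + g) / m := by field_simp
    have habs : |1 + g / m| ≤ n / m + 1 / 1000 := by
      rw [hg, abs_div, abs_of_pos hm, div_add' _ _ _ hm.ne', div_le_div_iff_of_pos_right hm, abs_le]
      constructor <;> linarith
    have hnm : 0 ≤ n / m := by positivity
    rcases le_total (1 / 10) (n / m) with h2 | h2
    · have : |1 + g / m| ^ (8 * p) ≤ (101 / 100 * (n / m)) ^ (8 * p) :=
        pow_le_pow_left₀ (abs_nonneg _) (by linarith) _
      linarith
    · have : |1 + g / m| ^ (8 * p) ≤ 1 := pow_le_one₀ (abs_nonneg _) (by linarith)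
      have : 0 ≤ (101 / 100 * (n / m)) ^ (8 * p) := by positivity
      linarith
  have h5 : (4 : ℝ) ^ p ≤ (101 / 100) ^ (8 * p) *
      ((𝔼 s ∈ X, 𝔼 s' ∈ X, (𝔼 w ∈ Ω, M s w * M s' w) ^ (8 * p)) / m ^ (8 * p)) + 1 := by
    refine h4.trans ((Finset.expect_le_expect fun s hs => Finset.expect_le_expect fun s' hs' =>
      hpt s hs s' hs').trans_eq ?_)
    simp_rw [Finset.expect_add_distrib, ← Finset.mul_expect, ← Finset.expect_div,
      Finset.expect_const hX]
  have h6 : (18 / 5 : ℝ) ^ p + 1 ≤ 4 ^ p := by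
    induction p, hp using Nat.le_induction with
    | base => norm_num
    | succ k hk ih =>
      have : (18 / 5 : ℝ) ^ k + 1 ≤ 4 ^ k := by
        clear * - hk
        induction k, hk using Nat.le_induction with
        | base => norm_num
        | succ k hk ih => rw [pow_succ, pow_succ]; nlinarith [show (0 : ℝ) < 4 ^ k by positivity]
      rw [pow_succ, pow_succ]; nlinarith [show (0 : ℝ) < 4 ^ k by positivity]
  set S := 𝔼 s ∈ X, 𝔼 s' ∈ X, (𝔼 w ∈ Ω, M s w * M s' w) ^ (8 * p)
  have h7 : (101 / 100 : ℝ) ^ (8 * p) ≤ (9 / 8) ^ p := by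
    rw [pow_mul]; exact pow_le_pow_left₀ (by positivity) (by norm_num) _
  have hmp : 0 < m ^ (8 * p) := by positivity
  have hS : 0 ≤ S := Finset.expect_nonneg fun s _ => Finset.expect_nonneg fun s' _ =>
    pow_nonneg (Finset.expect_nonneg fun w _ => mul_nonneg (hM _ _) (hM _ _)) _
  have h8 : (18 / 5 : ℝ) ^ p ≤ (9 / 8) ^ p * (S / m ^ (8 * p)) := by
    have : (101 / 100 : ℝ) ^ (8 * p) * (S / m ^ (8 * p)) ≤ (9 / 8) ^ p * (S / m ^ (8 * p)) := by
      gcongr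
    linarith
  have h9 : (18 / 5 : ℝ) ^ p = (9 / 8) ^ p * (16 / 5) ^ p := by
    rw [← mul_pow]; norm_num
  rw [h9] at h8
  have h10 := le_of_mul_le_mul_left h8 (by positivity)
  rwa [le_div_iff₀ hmp] at h10

/-- Dependent random choice (sifting): large moments of the pair correlation yield a dense set of
rows on which almost every pair has large correlation. -/
theorem sift {X : Finset α} (hX : X.Nonempty) {Ω : Finset ω} (hΩ : Ω.Nonempty) (M : α → ω → ℝ)
    (hM : ∀ s w, M s w = 0 ∨ M s w = 1) {p : ℕ} (hp : 18 ≤ p) {m : ℝ} (hm : 0 < m)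
    (h : (16 / 5) ^ p * m ^ (8 * p) ≤
      𝔼 s ∈ X, 𝔼 s' ∈ X, (𝔼 w ∈ Ω, M s w * M s' w) ^ (8 * p)) :
    ∃ A ⊆ X, m ^ (4 * p) * X.card ≤ A.card ∧
      99 / 100 ≤ 𝔼 s ∈ A, 𝔼 s' ∈ A,
        if 11 / 10 * m ≤ 𝔼 w ∈ Ω, M s w * M s' w then (1 : ℝ) else 0 := by
  set n : α → α → ℝ := fun s s' => 𝔼 w ∈ Ω, M s w * M s' w with hn
  set c : α → α → ℝ := fun s s' => 1 - 100 * if 11 / 10 * m ≤ n s s' then (0 : ℝ) else 1 with hc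
  have hM0 : ∀ s w, 0 ≤ M s w := fun s w => by rcases hM s w with h | h <;> simp [h]
  have hn0 : ∀ s s', 0 ≤ n s s' := fun s s' =>
    Finset.expect_nonneg fun w _ => mul_nonneg (hM0 _ _) (hM0 _ _)
  have hmain : m ^ (8 * p) ≤ 𝔼 s ∈ X, 𝔼 s' ∈ X, c s s' * n s s' ^ (8 * p) := by
    have h1 : ∀ s ∈ X, ∀ s' ∈ X,
        n s s' ^ (8 * p) - 100 * (11 / 10 * m) ^ (8 * p) ≤ c s s' * n s s' ^ (8 * p) := by
      intro s _ s' _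
      simp only [hc]
      have := hn0 s s'
      split_ifs with hh
      · have : 0 ≤ (11 / 10 * m) ^ (8 * p) := by positivity
        linarith
      · have := pow_le_pow_left₀ this (not_le.1 hh).le (8 * p)
        linarith
    have h2 := Finset.expect_le_expect fun s hs => Finset.expect_le_expect fun s' hs' =>
      h1 s hs s' hs'
    simp_rw [Finset.expect_sub_distrib, Finset.expect_const hX] at h2
    refine le_trans ?_ h2
    have h3 : (11 / 10 * m) ^ (8 * p) ≤ (43 / 20) ^ p * m ^ (8 * p) := by
      rw [mul_pow]
      gcongr
      rw [pow_mul]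
      exact pow_le_pow_left₀ (by positivity) (by norm_num) _
    have h4 : 101 * (43 / 20 : ℝ) ^ p ≤ (16 / 5) ^ p := by
      have e : (16 / 5 : ℝ) ^ p = (64 / 43) ^ p * (43 / 20) ^ p := by rw [← mul_pow]; norm_num
      rw [e]
      gcongr
      calc (101 : ℝ) ≤ (64 / 43) ^ 18 := by norm_num
        _ ≤ (64 / 43) ^ p := pow_le_pow_right₀ (by norm_num) hp
    have h5 : (1 : ℝ) ≤ (43 / 20) ^ p := one_le_pow₀ (by norm_num)
    have hmp : 0 < m ^ (8 * p) := by positivity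
    nlinarith
  have hexp : 𝔼 s ∈ X, 𝔼 s' ∈ X, c s s' * n s s' ^ (8 * p) =
      𝔼 f ∈ Fintype.piFinset (fun _ : Fin (8 * p) => Ω),
        𝔼 s ∈ X, 𝔼 s' ∈ X, c s s' * ((∏ i, M s (f i)) * ∏ i, M s' (f i)) := by
    rw [Finset.expect_comm (s := Fintype.piFinset _)]
    refine Finset.expect_congr rfl fun s _ => ?_
    rw [Finset.expect_comm (s := Fintype.piFinset _)]
    refine Finset.expect_congr rfl fun s' _ => ?_
    rw [← Finset.mul_expect, hn, Finset.expect_pow]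
    simp_rw [Finset.prod_mul_distrib]
  rw [hexp] at hmain
  obtain ⟨f, -, hf⟩ := Finset.exists_le_of_le_expect
    ((Fintype.piFinset_nonempty).2 fun _ => hΩ) hmain
  set A := X.filter fun s => ∏ i, M s (f i) = 1 with hA
  have hi : ∀ s, ∏ i, M s (f i) = if ∏ i, M s (f i) = 1 then 1 else 0 := by
    intro s
    by_cases h1 : ∀ i, M s (f i) = 1
    · simp [h1]
    · push Not at h1
      obtain ⟨i, hi⟩ := h1
      rw [Finset.prod_eq_zero (Finset.mem_univ i) ((hM _ _).resolve_right hi)]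
      simp
  have hsum : 𝔼 s ∈ X, 𝔼 s' ∈ X, c s s' * ((∏ i, M s (f i)) * ∏ i, M s' (f i)) =
      (∑ s ∈ A, ∑ s' ∈ A, c s s') / (X.card : ℝ) ^ 2 := by
    rw [expect_expect_eq_sum_div]
    congr 1
    simp_rw [hA, Finset.sum_filter]
    refine Finset.sum_congr rfl fun s _ => ?_
    rw [hi s]
    by_cases hs : ∏ i, M s (f i) = 1
    · simp only [hs, if_true, one_mul]
      refine Finset.sum_congr rfl fun s' _ => ?_
      rw [hi s']
      by_cases hs' : ∏ i, M s' (f i) = 1 <;> simp [hs']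
    · simp [hs]
  have hXc : (0 : ℝ) < X.card := by exact_mod_cast hX.card_pos
  rw [hsum, le_div_iff₀ (pow_pos hXc 2)] at hf
  have hcsum : ∑ s ∈ A, ∑ s' ∈ A, c s s' = 100 * (∑ s ∈ A, ∑ s' ∈ A,
      if 11 / 10 * m ≤ n s s' then (1 : ℝ) else 0) - 99 * (A.card : ℝ) ^ 2 := by
    have : ∀ s s', c s s' = 100 * (if 11 / 10 * m ≤ n s s' then (1 : ℝ) else 0) - 99 := by
      intro s s'
      simp only [hc]
      split_ifs <;> norm_num
    simp_rw [this, Finset.sum_sub_distrib, Finset.sum_const, ← Finset.mul_sum, nsmul_eq_mul]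
    ring
  have hcle : ∑ s ∈ A, ∑ s' ∈ A, (if 11 / 10 * m ≤ n s s' then (1 : ℝ) else 0) ≤
      (A.card : ℝ) ^ 2 := by
    calc _ ≤ ∑ s ∈ A, ∑ s' ∈ A, (1 : ℝ) := by
          gcongr; split_ifs <;> norm_num
      _ = _ := by rw [sq]; simp
  have hpos : 0 < m ^ (8 * p) * (X.card : ℝ) ^ 2 := mul_pos (pow_pos hm _) (pow_pos hXc 2)
  have hsq : (m ^ (4 * p) * X.card) ^ 2 ≤ (A.card : ℝ) ^ 2 := by
    have e : (m ^ (4 * p) * X.card) ^ 2 = m ^ (8 * p) * (X.card : ℝ) ^ 2 := by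
      rw [mul_pow, ← pow_mul]; congr 2; ring
    rw [e]; linarith
  refine ⟨A, Finset.filter_subset _ _, (pow_le_pow_iff_left₀
    (mul_pos (pow_pos hm _) hXc).le (Nat.cast_nonneg _) two_ne_zero).1 hsq, ?_⟩
  have hAc : (0 : ℝ) < (A.card : ℝ) ^ 2 := by
    have : 0 < (m ^ (4 * p) * X.card) ^ 2 := pow_pos (mul_pos (pow_pos hm _) hXc) 2
    linarith
  rw [expect_expect_eq_sum_div]
  rw [le_div_iff₀ hAc]
  linarith

end Grid

section WeightedBohr
variable [AddCommGroup G] [Fintype G]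

/-- The Bohr set of radius `r` attached to a system of weights `w` on the characters of `G`. -/
def wbohr (w : AddChar G ℂ → ℝ) (r : ℝ) : Finset G :=
  Finset.univ.filter fun x => ∀ γ : AddChar G ℂ, w γ * ‖1 - γ x‖ ≤ r

theorem mem_wbohr {w : AddChar G ℂ → ℝ} {r : ℝ} {x : G} :
    x ∈ wbohr w r ↔ ∀ γ : AddChar G ℂ, w γ * ‖1 - γ x‖ ≤ r := by
  simp [wbohr]

theorem norm_one_sub_char_add_le (γ : AddChar G ℂ) (x y : G) :
    ‖1 - γ (x + y)‖ ≤ ‖1 - γ x‖ + ‖1 - γ y‖ := by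
  rw [AddChar.map_add_eq_mul, show 1 - γ x * γ y = (1 - γ x) + γ x * (1 - γ y) by ring]
  exact (norm_add_le _ _).trans (by rw [norm_mul, AddChar.norm_apply, one_mul])

theorem norm_one_sub_char_neg (γ : AddChar G ℂ) (x : G) : ‖1 - γ (-x)‖ = ‖1 - γ x‖ := by
  have : 1 - γ x = -(γ x * (1 - γ (-x))) := by
    rw [mul_sub, ← AddChar.map_add_eq_mul]; simp
  rw [this, norm_neg, norm_mul, AddChar.norm_apply, one_mul]

theorem norm_char_sub_char (γ : AddChar G ℂ) (x y : G) : ‖γ x - γ y‖ = ‖1 - γ (x - y)‖ := by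
  have : γ x - γ y = -(γ y * (1 - γ (x - y))) := by
    rw [mul_sub, ← AddChar.map_add_eq_mul]; simp
  rw [this, norm_neg, norm_mul, AddChar.norm_apply, one_mul]

theorem zero_mem_wbohr (w : AddChar G ℂ → ℝ) {r : ℝ} (hr : 0 ≤ r) : 0 ∈ wbohr w r := by
  simp [mem_wbohr, hr]

theorem wbohr_nonempty (w : AddChar G ℂ → ℝ) {r : ℝ} (hr : 0 ≤ r) : (wbohr w r).Nonempty :=
  ⟨0, zero_mem_wbohr w hr⟩

theorem neg_mem_wbohr {w : AddChar G ℂ → ℝ} {r : ℝ} {x : G} (hx : x ∈ wbohr w r) :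
    -x ∈ wbohr w r := by
  rw [mem_wbohr] at *
  simpa only [norm_one_sub_char_neg] using hx

theorem wbohr_mono (w : AddChar G ℂ → ℝ) {r r' : ℝ} (h : r ≤ r') : wbohr w r ⊆ wbohr w r' :=
  fun _ hx => mem_wbohr.2 fun γ => (mem_wbohr.1 hx γ).trans h

theorem add_mem_wbohr {w : AddChar G ℂ → ℝ} (hw : ∀ γ, 0 ≤ w γ) {a b r : ℝ} {x y : G}
    (hx : x ∈ wbohr w a) (hy : y ∈ wbohr w b) (hab : a + b ≤ r) : x + y ∈ wbohr w r := by
  refine mem_wbohr.2 fun γ => ?_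
  have h1 := mem_wbohr.1 hx γ
  have h2 := mem_wbohr.1 hy γ
  have h3 := mul_le_mul_of_nonneg_left (norm_one_sub_char_add_le γ x y) (hw γ)
  linarith

theorem sub_mem_wbohr {w : AddChar G ℂ → ℝ} (hw : ∀ γ, 0 ≤ w γ) {a b r : ℝ} {x y : G}
    (hx : x ∈ wbohr w a) (hy : y ∈ wbohr w b) (hab : a + b ≤ r) : x - y ∈ wbohr w r := by
  rw [sub_eq_add_neg]
  exact add_mem_wbohr hw hx (neg_mem_wbohr hy) hab

/-- Covering bound for Bohr sets. -/
theorem card_le_mul_card_wbohr {w : AddChar G ℂ → ℝ} (hw : ∀ γ, 0 ≤ w γ)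
    {S : Finset (AddChar G ℂ)} (hS : ∀ γ ∉ S, w γ = 0) (J : ℕ) {r : ℝ} (hr : 0 < r)
    (U : Finset G) (hU : ∀ x ∈ U, ∀ γ : AddChar G ℂ, w γ * ‖1 - γ x‖ ≤ J * r) :
    U.card ≤ ((4 * J + 1) ^ 2) ^ S.card * (wbohr w r).card := by
  set f : G → S → ℤ × ℤ := fun x γ =>
    (⌊2 * (w γ * (γ.1 x - 1).re) / r⌋, ⌊2 * (w γ * (γ.1 x - 1).im) / r⌋) with hf
  set I : Finset ℤ := Finset.Icc (-(2 * J : ℤ)) (2 * J) with hI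
  have hIc : I.card = 4 * J + 1 := by
    rw [hI, Int.card_Icc]; omega
  have hfl : ∀ t : ℝ, |t| ≤ J * r → ⌊2 * t / r⌋ ∈ I := by
    intro t ht
    rw [abs_le] at ht
    rw [hI, Finset.mem_Icc]
    constructor
    · rw [Int.le_floor, le_div_iff₀ hr]; push_cast; linarith
    · rw [← Int.lt_add_one_iff, Int.floor_lt, div_lt_iff₀ hr]; push_cast; linarith
  have hmaps : ∀ x ∈ U, f x ∈ Fintype.piFinset fun _ : S => I ×ˢ I := by
    intro x hx
    rw [Fintype.mem_piFinset]
    intro γ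
    have h := hU x hx γ
    rw [norm_sub_rev] at h
    rw [Finset.mem_product]
    refine ⟨hfl _ ?_, hfl _ ?_⟩ <;> rw [abs_mul, abs_of_nonneg (hw _)] <;> refine le_trans ?_ h
    · exact mul_le_mul_of_nonneg_left (Complex.abs_re_le_norm _) (hw _)
    · exact mul_le_mul_of_nonneg_left (Complex.abs_im_le_norm _) (hw _)
  have h := Finset.card_le_mul_card_image_of_maps_to hmaps (wbohr w r).card ?_
  · rw [Fintype.card_piFinset, Finset.prod_const, Finset.card_univ, Finset.card_product, hIc, ← sq,
      Fintype.card_coe] at h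
    rwa [mul_comm] at h
  · intro b _
    rcases (U.filter fun x => f x = b).eq_empty_or_nonempty with h0 | ⟨y, hy⟩
    · rw [h0]; simp
    rw [← Finset.card_image_of_injective _ (sub_left_injective (b := y))]
    refine Finset.card_le_card fun z hz => ?_
    obtain ⟨x, hx, rfl⟩ := Finset.mem_image.1 hz
    rw [mem_wbohr]
    intro γ
    by_cases hγ : γ ∈ S
    · have hxy : f x ⟨γ, hγ⟩ = f y ⟨γ, hγ⟩ := by
        rw [(Finset.mem_filter.1 hx).2, (Finset.mem_filter.1 hy).2]
      simp only [hf, Prod.mk.injEq] at hxy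
      have h1 := Int.abs_sub_lt_one_of_floor_eq_floor hxy.1
      have h2 := Int.abs_sub_lt_one_of_floor_eq_floor hxy.2
      rw [← sub_div, abs_div, abs_of_pos hr, div_lt_one hr, ← mul_sub, ← mul_sub, abs_mul,
        abs_mul, abs_of_nonneg (hw _)] at h1 h2
      rw [abs_two] at h1 h2
      rw [← norm_char_sub_char]
      have h3 := Complex.norm_le_abs_re_add_abs_im (γ x - γ y)
      simp only [Complex.sub_re, Complex.sub_im, Complex.one_re, Complex.one_im,
        sub_sub_sub_cancel_right] at h1 h2 h3
      nlinarith [mul_le_mul_of_nonneg_left h3 (hw γ)]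
    · rw [hS γ hγ]; simp [hr.le]

/-- A Bohr set of rank `≤ D` has a regular dilate. -/
theorem exists_regular_radius {w : AddChar G ℂ → ℝ} (hw : ∀ γ, 0 ≤ w γ)
    {S : Finset (AddChar G ℂ)} (hS : ∀ γ ∉ S, w γ = 0) {D E : ℕ} (hD : 1 ≤ D) (hE : 1 ≤ E)
    (hSD : S.card ≤ D) {r : ℝ} (hr : 0 < r) :
    ∃ r', r / 2 ≤ r' ∧ r' ≤ r ∧
      ((wbohr w (r' + 1 / (14 * D * E) * r)).card : ℝ) ≤ (1 + 1 / E) * (wbohr w r').card := by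
  have hD' : (1 : ℝ) ≤ D := by exact_mod_cast hD
  have hE' : (1 : ℝ) ≤ E := by exact_mod_cast hE
  set η : ℝ := 1 / (14 * D * E) * r with hη
  have hη0 : 0 < η := by positivity
  have hηN : (7 * D * E : ℕ) * η = r / 2 := by
    rw [hη]; push_cast; field_simp; norm_num
  by_contra! hcon
  have hstep : ∀ i : ℕ, i ≤ 7 * D * E →
      (1 + 1 / E : ℝ) ^ i * (wbohr w (r / 2)).card ≤ (wbohr w (r / 2 + i * η)).card := by
    intro i
    induction i with
    | zero => simp
    | succ i ih =>
      intro hi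
      have h1 := ih (by omega)
      have h2 := hcon (r / 2 + i * η) (by have : 0 ≤ i * η := by positivity
                                          linarith) (by
        have : (i : ℝ) * η ≤ (7 * D * E : ℕ) * η := by
          gcongr; omega
        linarith)
      have e : r / 2 + ((i + 1 : ℕ) : ℝ) * η = r / 2 + i * η + η := by push_cast; ring
      rw [e, pow_succ, mul_comm ((1 + 1 / (E : ℝ)) ^ i), mul_assoc]
      exact (mul_le_mul_of_nonneg_left h1 (by positivity)).trans h2.le
  have hN := hstep _ le_rfl
  rw [hηN, add_halves] at hN
  have hB := card_le_mul_card_wbohr hw hS 2 (half_pos hr) (wbohr w r) fun x hx γ => by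
    have := mem_wbohr.1 hx γ
    push_cast; linarith
  have hc : 0 < (wbohr w (r / 2)).card := (wbohr_nonempty w (half_pos hr).le).card_pos
  have hB' : ((wbohr w r).card : ℝ) ≤ 81 ^ D * (wbohr w (r / 2)).card := by
    have h1 : (81 : ℕ) ^ S.card ≤ 81 ^ D := Nat.pow_le_pow_right (by norm_num) hSD
    have h2 : (wbohr w r).card ≤ 81 ^ D * (wbohr w (r / 2)).card := by
      refine hB.trans ?_
      norm_num
      exact Nat.mul_le_mul_right _ h1
    exact_mod_cast h2
  have h2 : (2 : ℝ) ≤ (1 + 1 / E) ^ E := by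
    have := one_add_mul_le_pow (a := 1 / (E : ℝ)) (by have : 0 < 1 / (E : ℝ) := by positivity
                                                      linarith) E
    have e : (E : ℝ) * (1 / E) = 1 := by field_simp
    linarith
  have h3 : (128 : ℝ) ^ D ≤ (1 + 1 / E) ^ (7 * D * E) := by
    rw [show 7 * D * E = E * (7 * D) by ring, pow_mul, show (128 : ℝ) = 2 ^ 7 by norm_num,
      ← pow_mul]
    exact pow_le_pow_left₀ (by norm_num) h2 _
  have h4 : (81 : ℝ) ^ D < 128 ^ D := pow_lt_pow_left₀ (by norm_num) (by norm_num) (by omega)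
  have h5 : (0 : ℝ) < (wbohr w (r / 2)).card := by exact_mod_cast hc
  nlinarith

theorem norm_sum_shift_sub_le {F : Type*} [NormedAddCommGroup F] {w : AddChar G ℂ → ℝ}
    (hw : ∀ γ, 0 ≤ w γ) {r η : ℝ} (hη : 0 ≤ η) {y : G} (hy : y ∈ wbohr w η)
    (f : G → F) {C : ℝ} (hf : ∀ x, ‖f x‖ ≤ C) :
    ‖∑ v ∈ wbohr w r, f (v + y) - ∑ v ∈ wbohr w r, f v‖ ≤
      2 * C * ((wbohr w (r + η)).card - (wbohr w r).card) := by
  have hC : 0 ≤ C := (norm_nonneg _).trans (hf 0)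
  set V := wbohr w r
  set V' := wbohr w (r + η)
  have hV : V ⊆ V' := wbohr_mono w (by linarith)
  set T := V.map (addRightEmbedding y) with hT
  have hTV : T ⊆ V' := by
    intro z hz
    obtain ⟨x, hx, rfl⟩ := Finset.mem_map.1 hz
    exact add_mem_wbohr hw hx hy le_rfl
  have e1 : ∑ v ∈ V, f (v + y) = ∑ z ∈ T, f z := by rw [hT, Finset.sum_map]; rfl
  have hbd : ∀ U ⊆ V', U.card = V.card →
      ‖∑ z ∈ V', f z - ∑ z ∈ U, f z‖ ≤ C * ((V'.card : ℝ) - V.card) := by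
    intro U hU hUc
    rw [← Finset.sum_sdiff hU, add_sub_cancel_right]
    refine (norm_sum_le_of_le _ fun z _ => hf z).trans ?_
    rw [Finset.sum_const, nsmul_eq_mul, Finset.card_sdiff_of_subset hU,
      Nat.cast_sub (Finset.card_le_card hU), hUc, mul_comm]
  have h1 := hbd T hTV (by simp [hT])
  have h2 := hbd V hV rfl
  rw [e1, show ∑ z ∈ T, f z - ∑ v ∈ V, f v =
    (∑ z ∈ V', f z - ∑ v ∈ V, f v) - (∑ z ∈ V', f z - ∑ z ∈ T, f z) by abel]
  refine (norm_sub_le _ _).trans ?_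
  linarith

theorem norm_expect_shift_sub_le {w : AddChar G ℂ → ℝ}
    (hw : ∀ γ, 0 ≤ w γ) {r η ε : ℝ} (hr : 0 ≤ r) (hη : 0 ≤ η)
    (hreg : ((wbohr w (r + η)).card : ℝ) ≤ (1 + ε) * (wbohr w r).card)
    {y : G} (hy : y ∈ wbohr w η) (f : G → ℂ) {C : ℝ} (hf : ∀ x, ‖f x‖ ≤ C) :
    ‖𝔼 v ∈ wbohr w r, f (v + y) - 𝔼 v ∈ wbohr w r, f v‖ ≤ 2 * C * ε := by
  have hC : 0 ≤ C := (norm_nonneg _).trans (hf 0)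
  have hc : (0 : ℝ) < (wbohr w r).card := by exact_mod_cast (wbohr_nonempty w hr).card_pos
  have h := norm_sum_shift_sub_le hw (r := r) hη hy f hf
  rw [Finset.expect_eq_sum_div_card, Finset.expect_eq_sum_div_card, ← sub_div, norm_div,
    Complex.norm_natCast, div_le_iff₀ hc]
  nlinarith

theorem abs_expect_shift_sub_le {w : AddChar G ℂ → ℝ}
    (hw : ∀ γ, 0 ≤ w γ) {r η ε : ℝ} (hr : 0 ≤ r) (hη : 0 ≤ η)
    (hreg : ((wbohr w (r + η)).card : ℝ) ≤ (1 + ε) * (wbohr w r).card)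
    {y : G} (hy : y ∈ wbohr w η) (f : G → ℝ) (hf0 : ∀ x, 0 ≤ f x) (hf1 : ∀ x, f x ≤ 1) :
    |𝔼 v ∈ wbohr w r, f (v + y) - 𝔼 v ∈ wbohr w r, f v| ≤ ε := by
  have hne := wbohr_nonempty w hr
  have hc : (0 : ℝ) < (wbohr w r).card := by exact_mod_cast hne.card_pos
  have h := norm_sum_shift_sub_le hw (r := r) hη hy (fun x => f x - 1 / 2) (C := 1 / 2)
    fun x => by rw [Real.norm_eq_abs, abs_le]; constructor <;> linarith [hf0 x, hf1 x]
  rw [Finset.sum_sub_distrib, Finset.sum_sub_distrib, sub_sub_sub_cancel_right,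
    Real.norm_eq_abs] at h
  rw [Finset.expect_eq_sum_div_card, Finset.expect_eq_sum_div_card, ← sub_div, abs_div,
    Nat.abs_cast, div_le_iff₀ hc]
  linarith

end WeightedBohr

section AlmostPeriodicity

theorem exp_le_one_add_add_sq {x : ℝ} (hx : |x| ≤ 1) : Real.exp x ≤ 1 + x + x ^ 2 := by
  have := (abs_le.1 (Real.abs_exp_sub_one_sub_id_le hx)).2
  linarith

theorem expect_exp_mul_le {α : Type*} {A : Finset α} (hA : A.Nonempty) (X : α → ℝ)
    (hX : ∀ a ∈ A, |X a| ≤ 1) (h0 : 𝔼 a ∈ A, X a = 0) {s : ℝ} (hs0 : |s| ≤ 1) :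
    𝔼 a ∈ A, Real.exp (s * X a) ≤ Real.exp (s ^ 2) := by
  have h1 : ∀ a ∈ A, Real.exp (s * X a) ≤ 1 + s * X a + s ^ 2 := by
    intro a ha
    have hle : |s * X a| ≤ 1 := by
      rw [abs_mul]; exact mul_le_one₀ hs0 (abs_nonneg _) (hX a ha)
    have h2 : X a ^ 2 ≤ 1 := by rw [← sq_abs]; exact pow_le_one₀ (abs_nonneg _) (hX a ha)
    have := exp_le_one_add_add_sq hle
    rw [mul_pow] at this
    nlinarith [sq_nonneg s]
  refine (Finset.expect_le_expect h1).trans ?_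
  rw [Finset.expect_add_distrib, Finset.expect_add_distrib, ← Finset.mul_expect, h0,
    Finset.expect_const hA, Finset.expect_const hA]
  have := Real.add_one_le_exp (s ^ 2)
  linarith

/-- One-sided Hoeffding bound for sampling with replacement from a finite set. -/
theorem expect_indicator_sum_gt_le {α : Type*} {A : Finset α} (hA : A.Nonempty) (X : α → ℝ)
    (hX : ∀ a ∈ A, |X a| ≤ 1) (h0 : 𝔼 a ∈ A, X a = 0) {ε : ℝ} (hε : 0 < ε) (hε1 : ε ≤ 1)
    (N : ℕ) :
    𝔼 a ∈ Fintype.piFinset (fun _ : Fin N => A),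
      (if N * ε < ∑ i, X (a i) then (1 : ℝ) else 0) ≤ Real.exp (-(N * ε ^ 2 / 4)) := by
  have h1 : ∀ a ∈ Fintype.piFinset (fun _ : Fin N => A),
      (if N * ε < ∑ i, X (a i) then (1 : ℝ) else 0) ≤
        Real.exp (-(ε / 2 * (N * ε))) * ∏ i, Real.exp (ε / 2 * X (a i)) := by
    intro a _
    rw [← Real.exp_sum, ← Finset.mul_sum, ← Real.exp_add]
    split_ifs with h
    · rw [Real.one_le_exp_iff]
      nlinarith
    · positivity
  refine (Finset.expect_le_expect h1).trans ?_
  rw [← Finset.mul_expect, ← Finset.expect_pow A (fun a => Real.exp (ε / 2 * X a)) N]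
  have h2 := expect_exp_mul_le hA X hX h0 (s := ε / 2) (by rw [abs_of_pos] <;> linarith)
  have h3 : (𝔼 a ∈ A, Real.exp (ε / 2 * X a)) ^ N ≤ Real.exp ((ε / 2) ^ 2) ^ N :=
    pow_le_pow_left₀ (Finset.expect_nonneg fun _ _ => (Real.exp_pos _).le) h2 N
  refine (mul_le_mul_of_nonneg_left h3 (Real.exp_pos _).le).trans ?_
  rw [← Real.exp_nat_mul, ← Real.exp_add]
  apply Real.exp_le_exp.2
  linarith

variable [AddCommGroup G]

/-- The samples `a` for which the empirical average of `T (z - aᵢ)` is close to its mean for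
almost all `z ∈ Y`. -/
def goodSamples (A Y : Finset G) (T : G → ℝ) (ε : ℝ) (N : ℕ) : Finset (Fin N → G) :=
  (Fintype.piFinset fun _ : Fin N => A).filter fun a =>
    ((Y.filter fun z => N * ε < |∑ i, (T (z - a i) - 𝔼 b ∈ A, T (z - b))|).card : ℝ) ≤ ε * A.card

theorem half_card_le_card_goodSamples {A Y : Finset G} (hA : A.Nonempty) {δ : ℝ}
    (hAY : δ * Y.card ≤ A.card) (T : G → ℝ) (hT0 : ∀ x, 0 ≤ T x) (hT1 : ∀ x, T x ≤ 1)
    {ε : ℝ} (hε : 0 < ε) (hε1 : ε ≤ 1) {N : ℕ}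
    (hN : 2 * Real.exp (-(N * ε ^ 2 / 4)) ≤ ε * δ / 2) :
    (A.card : ℝ) ^ N / 2 ≤ (goodSamples A Y T ε N).card := by
  set P := Fintype.piFinset fun _ : Fin N => A with hP
  have hPne : P.Nonempty := Fintype.piFinset_nonempty.2 fun _ => hA
  have hPc : (P.card : ℝ) = (A.card : ℝ) ^ N := by
    rw [hP, Fintype.card_piFinset, Finset.prod_const, Finset.card_univ, Fintype.card_fin]
    push_cast; rfl
  set h : G → ℝ := fun z => 𝔼 b ∈ A, T (z - b) with hh
  have hh0 : ∀ z, 0 ≤ h z := fun z => Finset.expect_nonneg fun b _ => hT0 _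
  have hh1 : ∀ z, h z ≤ 1 := fun z => Finset.expect_le hA fun b _ => hT1 _
  set B : (Fin N → G) → ℝ := fun a =>
    ((Y.filter fun z => N * ε < |∑ i, (T (z - a i) - h z)|).card : ℝ) with hB
  have htail : ∀ z, 𝔼 a ∈ P, (if N * ε < |∑ i, (T (z - a i) - h z)| then (1 : ℝ) else 0) ≤
      2 * Real.exp (-(N * ε ^ 2 / 4)) := by
    intro z
    have hX : ∀ a ∈ A, |T (z - a) - h z| ≤ 1 := fun a _ => by
      rw [abs_le]
      constructor <;> linarith [hT0 (z - a), hT1 (z - a), hh0 z, hh1 z]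
    have h0 : 𝔼 a ∈ A, (T (z - a) - h z) = 0 := by
      rw [Finset.expect_sub_distrib, Finset.expect_const hA, hh, sub_self]
    have t1 := expect_indicator_sum_gt_le hA (fun a => T (z - a) - h z) hX h0 hε hε1 N
    have t2 := expect_indicator_sum_gt_le hA (fun a => -(T (z - a) - h z))
      (fun a ha => by rw [abs_neg]; exact hX a ha)
      (by rw [Finset.expect_neg_distrib, h0, neg_zero]) hε hε1 N
    have : 𝔼 a ∈ P, (if N * ε < |∑ i, (T (z - a i) - h z)| then (1 : ℝ) else 0) ≤
        𝔼 a ∈ P, ((if N * ε < ∑ i, (T (z - a i) - h z) then (1 : ℝ) else 0) +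
          (if N * ε < ∑ i, -(T (z - a i) - h z) then (1 : ℝ) else 0)) := by
      refine Finset.expect_le_expect fun a _ => ?_
      rw [Finset.sum_neg_distrib]
      by_cases hc : N * ε < |∑ i, (T (z - a i) - h z)|
      · rw [if_pos hc]
        rcases lt_abs.1 hc with h1 | h1
        · rw [if_pos h1]; split_ifs <;> norm_num
        · rw [if_pos h1]; split_ifs <;> norm_num
      · rw [if_neg hc]; split_ifs <;> norm_num
    rw [Finset.expect_add_distrib] at this
    linarith
  have hEB : 𝔼 a ∈ P, B a ≤ ε * A.card / 2 := by
    have e : ∀ a, B a = ∑ z ∈ Y, if N * ε < |∑ i, (T (z - a i) - h z)| then (1 : ℝ) else 0 := by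
      intro a; simp [hB]
    simp_rw [e, Finset.expect_sum_comm]
    refine (Finset.sum_le_sum fun z _ => htail z).trans ?_
    rw [Finset.sum_const, nsmul_eq_mul]
    have := mul_le_mul_of_nonneg_left hN (Nat.cast_nonneg (α := ℝ) Y.card)
    nlinarith
  have hεA : 0 < ε * A.card := mul_pos hε (by exact_mod_cast hA.card_pos)
  have hPpos : (0 : ℝ) < P.card := by exact_mod_cast hPne.card_pos
  have hgood : goodSamples A Y T ε N = P.filter fun a => B a ≤ ε * A.card := rfl
  have hsplit : ((P.filter fun a => B a ≤ ε * A.card).card : ℝ) +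
      (P.filter fun a => ¬ B a ≤ ε * A.card).card = P.card := by
    exact_mod_cast Finset.card_filter_add_card_filter_not (s := P) (fun a => B a ≤ ε * A.card)
  have hbad : ((P.filter fun a => ¬ B a ≤ ε * A.card).card : ℝ) * (ε * A.card) ≤
      P.card * (ε * A.card / 2) := by
    calc _ = ∑ a ∈ P.filter fun a => ¬ B a ≤ ε * A.card, ε * A.card := by
          rw [Finset.sum_const, nsmul_eq_mul]
      _ ≤ ∑ a ∈ P.filter fun a => ¬ B a ≤ ε * A.card, B a :=
          Finset.sum_le_sum fun a ha => (not_le.1 (Finset.mem_filter.1 ha).2).le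
      _ ≤ ∑ a ∈ P, B a := Finset.sum_le_sum_of_subset_of_nonneg (Finset.filter_subset _ _)
          fun a _ _ => Nat.cast_nonneg _
      _ = P.card * 𝔼 a ∈ P, B a := (Finset.card_mul_expect P B).symm
      _ ≤ _ := by gcongr
  have hbad' : ((P.filter fun a => ¬ B a ≤ ε * A.card).card : ℝ) ≤ P.card / 2 := by
    refine le_of_mul_le_mul_right ?_ hεA
    linarith
  rw [hgood, ← hPc]
  linarith

/-- Croot–Sisask almost periodicity for a difference convolution with a bounded function. -/
theorem almost_periodicity {A Y W₀ : Finset G} (hA : A.Nonempty)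
    (hAW : ∀ a ∈ A, ∀ w ∈ W₀, a + w ∈ Y) {δ : ℝ} (hδ : 0 < δ)
    (hAY : δ * Y.card ≤ A.card) (T : G → ℝ) (hT0 : ∀ x, 0 ≤ T x) (hT1 : ∀ x, T x ≤ 1)
    {ε : ℝ} (hε : 0 < ε) (hε1 : ε ≤ 1) {N : ℕ} (hN0 : 0 < N)
    (hN : 2 * Real.exp (-(N * ε ^ 2 / 4)) ≤ ε * δ / 2) :
    ∃ W ⊆ W₀, δ ^ N / 2 * W₀.card ≤ W.card ∧
      ∀ t, (∀ a ∈ A, a + t ∈ Y) → ∀ w ∈ W, ∀ w' ∈ W, (∀ a ∈ A, a + (t + (w - w')) ∈ Y) →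
        |𝔼 a ∈ A, 𝔼 b ∈ A, T (a + (t + (w - w')) - b) - 𝔼 a ∈ A, 𝔼 b ∈ A, T (a + t - b)| ≤
          4 * ε := by
  have hgood := half_card_le_card_goodSamples hA hAY T hT0 hT1 hε hε1 hN
  set Gd := goodSamples A Y T ε N with hGd
  have hAc : (0 : ℝ) < A.card := by exact_mod_cast hA.card_pos
  rcases W₀.eq_empty_or_nonempty with rfl | hW₀
  · exact ⟨∅, by simp, by simp, by simp⟩
  obtain ⟨w₁, hw₁⟩ := hW₀
  have hYne : Y.Nonempty := by
    obtain ⟨a, ha⟩ := hA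
    exact ⟨_, hAW a ha w₁ hw₁⟩
  have hYc : (0 : ℝ) < Y.card := by exact_mod_cast hYne.card_pos
  set Q := Fintype.piFinset fun _ : Fin N => Y with hQ
  have hQc : (Q.card : ℝ) = (Y.card : ℝ) ^ N := by
    rw [hQ, Fintype.card_piFinset, Finset.prod_const, Finset.card_univ, Fintype.card_fin]
    push_cast; rfl
  have hQne : Q.Nonempty := Fintype.piFinset_nonempty.2 fun _ => hYne
  set F : (Fin N → G) × G → Fin N → G := fun q i => q.1 i + q.2 with hF
  have hmaps : ∀ q ∈ Gd ×ˢ W₀, F q ∈ Q := by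
    intro q hq
    obtain ⟨h1, h2⟩ := Finset.mem_product.1 hq
    rw [hQ, Fintype.mem_piFinset]
    exact fun i => hAW _ (Fintype.mem_piFinset.1 (Finset.mem_filter.1 h1).1 i) _ h2
  have hcard : (Q.card : ℝ) * (δ ^ N / 2 * W₀.card) ≤ ((Gd ×ˢ W₀).card : ℝ) := by
    rw [hQc, Finset.card_product]
    push_cast
    calc (Y.card : ℝ) ^ N * (δ ^ N / 2 * W₀.card) = (δ * Y.card) ^ N / 2 * W₀.card := by
          rw [mul_pow]; ring
      _ ≤ (A.card : ℝ) ^ N / 2 * W₀.card := by gcongr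
      _ ≤ _ := by gcongr
  obtain ⟨c, -, hc⟩ := Finset.exists_le_card_fiber_of_nsmul_le_card_of_maps_to hmaps hQne
    (b := δ ^ N / 2 * (W₀.card : ℝ)) (by rw [nsmul_eq_mul]; exact hcard)
  set W := W₀.filter fun w => (fun i => c i - w) ∈ Gd with hW
  have hfib : ((Gd ×ˢ W₀).filter fun q => F q = c).card ≤ W.card := by
    refine Finset.card_le_card_of_injOn (fun q => q.2) ?_ ?_
    · intro q hq
      obtain ⟨h1, h2⟩ := Finset.mem_filter.1 hq
      obtain ⟨h3, h4⟩ := Finset.mem_product.1 h1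
      refine Finset.mem_filter.2 ⟨h4, ?_⟩
      have : (fun i => c i - q.2) = q.1 := by
        funext i; rw [← h2]; simp [hF]
      rwa [this]
    · intro q hq q' hq' hqq
      have h2 := (Finset.mem_filter.1 hq).2
      have h2' := (Finset.mem_filter.1 hq').2
      refine Prod.ext (funext fun i => ?_) hqq
      have e := congrFun (h2.trans h2'.symm) i
      simp only [hF] at e hqq
      rw [hqq] at e
      exact add_right_cancel e
  refine ⟨W, Finset.filter_subset _ _, hc.trans (by exact_mod_cast hfib), ?_⟩
  set g : G → ℝ := fun z => (∑ i, T (z - c i)) / N with hg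
  set h : G → ℝ := fun z => 𝔼 b ∈ A, T (z - b) with hh
  have hNpos : (0 : ℝ) < N := by exact_mod_cast hN0
  have hh0 : ∀ z, 0 ≤ h z := fun z => Finset.expect_nonneg fun b _ => hT0 _
  have hh1 : ∀ z, h z ≤ 1 := fun z => Finset.expect_le hA fun b _ => hT1 _
  have hg0 : ∀ z, 0 ≤ g z := fun z => div_nonneg (Finset.sum_nonneg fun i _ => hT0 _) hNpos.le
  have hg1 : ∀ z, g z ≤ 1 := fun z => by
    rw [hg, div_le_one hNpos]
    exact (Finset.sum_le_sum fun i _ => hT1 _).trans (by simp)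
  have hclose : ∀ w ∈ W, ∀ t, (∀ a ∈ A, a + t ∈ Y) →
      |𝔼 a ∈ A, h (a + t) - 𝔼 a ∈ A, g (a + t + w)| ≤ 2 * ε := by
    intro w hw t ht
    have hb := (Finset.mem_filter.1 (Finset.mem_filter.1 hw).2).2
    set Z := Y.filter fun z => N * ε < |∑ i, (T (z - (c i - w)) - 𝔼 b ∈ A, T (z - b))| with hZ
    have hpt : ∀ a ∈ A, |h (a + t) - g (a + t + w)| ≤ ε + if a + t ∈ Z then 1 else 0 := by
      intro a ha
      by_cases hz : a + t ∈ Z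
      · rw [if_pos hz, abs_le]
        constructor <;> linarith [hh0 (a + t), hh1 (a + t), hg0 (a + t + w), hg1 (a + t + w)]
      · rw [if_neg hz, add_zero]
        have hz' : |∑ i, (T (a + t - (c i - w)) - h (a + t))| ≤ N * ε := by
          by_contra hcon
          exact hz (Finset.mem_filter.2 ⟨ht a ha, not_le.1 hcon⟩)
        have e : ∑ i, (T (a + t - (c i - w)) - h (a + t)) =
            N * (g (a + t + w) - h (a + t)) := by
          rw [Finset.sum_sub_distrib, hg]
          simp only [Finset.sum_const, Finset.card_univ, Fintype.card_fin, nsmul_eq_mul]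
          rw [mul_sub, mul_div_cancel₀ _ hNpos.ne']
          congr 1
          exact Finset.sum_congr rfl fun i _ => congrArg T (by abel)
        rw [e, abs_mul, Nat.abs_cast] at hz'
        rw [abs_sub_comm]
        exact le_of_mul_le_mul_left hz' hNpos
    rw [← Finset.expect_sub_distrib]
    refine (Finset.abs_expect_le _ _).trans ((Finset.expect_le_expect hpt).trans ?_)
    rw [Finset.expect_add_distrib, Finset.expect_const hA, Finset.expect_eq_sum_div_card,
      Finset.sum_boole, two_mul]
    gcongr
    rw [div_le_iff₀ hAc]
    refine le_trans ?_ hb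
    exact_mod_cast Finset.card_le_card_of_injOn (fun a => a + t)
      (fun a ha => (Finset.mem_filter.1 ha).2) (fun a _ b _ hab => add_right_cancel hab)
  intro t ht w hw w' hw' ht'
  have h1 := abs_le.1 (hclose w hw t ht)
  have h2 := abs_le.1 (hclose w' hw' (t + (w - w')) ht')
  have e : ∀ a, a + (t + (w - w')) + w' = a + t + w := fun a => by abel
  simp_rw [e] at h2
  rw [abs_le]
  constructor <;> linarith [h1.1, h1.2, h2.1, h2.2]

/-- Averaging of `f` over the translates `z + w - w'` with `w, w' ∈ W`. -/
def diffAvg (W : Finset G) (f : G → ℝ) (z : G) : ℝ := 𝔼 w ∈ W, 𝔼 w' ∈ W, f (z + (w - w'))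

end AlmostPeriodicity

section AlmostPeriodicityBohr
variable [AddCommGroup G] [Fintype G]

theorem abs_diffAvg_iterate_sub_le {w : AddChar G ℂ → ℝ} (hw : ∀ γ, 0 ≤ w γ) {W : Finset G}
    (hWne : W.Nonempty) {ρ η : ℝ} (hW : W ⊆ wbohr w ρ) (H : G → ℝ) {ε : ℝ}
    (hH : ∀ t ∈ wbohr w η, ∀ u ∈ W, ∀ u' ∈ W, t + (u - u') ∈ wbohr w η →
      |H (t + (u - u')) - H t| ≤ ε) (hρ : 0 ≤ ρ)
    (k : ℕ) (σ : ℝ) (hσ : 2 * k * ρ + σ ≤ η) (t : G) (ht : t ∈ wbohr w σ) :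
    |(diffAvg W)^[k] H t - H t| ≤ k * ε := by
  induction k generalizing σ t with
  | zero => simp
  | succ k ih =>
    rw [Function.iterate_succ_apply']
    have hpt : ∀ u ∈ W, ∀ u' ∈ W, |(diffAvg W)^[k] H (t + (u - u')) - H t| ≤ (k + 1 : ℕ) * ε := by
      intro u hu u' hu'
      have hmem : t + (u - u') ∈ wbohr w (σ + 2 * ρ) :=
        add_mem_wbohr hw ht (sub_mem_wbohr hw (hW hu) (hW hu') le_rfl) (by linarith)
      push_cast at hσ ⊢
      have h0 : 0 ≤ 2 * (k : ℝ) * ρ := by positivity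
      have h1 := ih (σ + 2 * ρ) (by linarith) _ hmem
      have h2 := hH t (wbohr_mono w (by linarith) ht) u hu u' hu'
        (wbohr_mono w (by linarith) hmem)
      have h3 := abs_sub_le ((diffAvg W)^[k] H (t + (u - u'))) (H (t + (u - u'))) (H t)
      linarith
    have e : diffAvg W ((diffAvg W)^[k] H) t - H t =
        𝔼 u ∈ W, 𝔼 u' ∈ W, ((diffAvg W)^[k] H (t + (u - u')) - H t) := by
      simp_rw [Finset.expect_sub_distrib, Finset.expect_const hWne]
      rfl
    rw [e]
    refine (Finset.abs_expect_le _ _).trans (Finset.expect_le hWne fun u hu => ?_)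
    exact (Finset.abs_expect_le _ _).trans (Finset.expect_le hWne fun u' hu' => hpt u hu u' hu')

end AlmostPeriodicityBohr

section Fourier
variable [AddCommGroup G] [Fintype G]

/-- The unnormalised Fourier coefficient of a real function. -/
def fourierSum (P : G → ℝ) (γ : AddChar G ℂ) : ℂ := ∑ x, (P x : ℂ) * γ x

/-- The mean of a character over a finite set. -/
def charMean (W : Finset G) (γ : AddChar G ℂ) : ℂ := 𝔼 w ∈ W, γ w

/-- `f` has an absolutely summable Fourier series with `ℓ¹` norm at most `L`. -/
def WienerBound (f : G → ℝ) (L : ℝ) : Prop :=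
  ∃ c : AddChar G ℂ → ℂ, (∀ z, (f z : ℂ) = ∑ γ, c γ * γ z) ∧ ∑ γ, ‖c γ‖ ≤ L

theorem sum_norm_fourierSum_sq (P : G → ℝ) :
    ∑ γ, ‖fourierSum P γ‖ ^ 2 = Fintype.card G * ∑ x, P x ^ 2 := by
  have h : ((∑ γ, ‖fourierSum P γ‖ ^ 2 : ℝ) : ℂ) = (Fintype.card G * ∑ x, P x ^ 2 : ℝ) := by
    push_cast
    have e : ∀ γ : AddChar G ℂ, ((‖fourierSum P γ‖ : ℂ)) ^ 2 =
        ∑ x, ∑ y, (P x : ℂ) * P y * γ (x - y) := by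
      intro γ
      rw [← Complex.mul_conj', fourierSum, map_sum, Finset.sum_mul_sum]
      refine Finset.sum_congr rfl fun x _ => Finset.sum_congr rfl fun y _ => ?_
      rw [map_mul, Complex.conj_ofReal, ← AddChar.map_neg_eq_conj, sub_eq_add_neg,
        AddChar.map_add_eq_mul]
      ring
    simp_rw [e]
    rw [Finset.sum_comm, Finset.mul_sum]
    refine Finset.sum_congr rfl fun x _ => ?_
    rw [Finset.sum_comm]
    simp_rw [← Finset.mul_sum, AddChar.sum_apply_eq_ite, sub_eq_zero]
    simp
    ring
  exact_mod_cast h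

theorem wienerBound_correlation (P Q : G → ℝ) :
    WienerBound (fun z => ∑ v, P v * Q (v + z)) ((∑ x, P x ^ 2 + ∑ x, Q x ^ 2) / 2) := by
  have hG : (0 : ℝ) < Fintype.card G := by exact_mod_cast Fintype.card_pos
  refine ⟨fun γ => fourierSum P γ * (starRingEnd ℂ) (fourierSum Q γ) / Fintype.card G, ?_, ?_⟩
  · intro z
    have e : ∀ γ : AddChar G ℂ,
        fourierSum P γ * (starRingEnd ℂ) (fourierSum Q γ) / Fintype.card G * γ z =
        (∑ v, ∑ x, (P v : ℂ) * Q x * γ (v - x + z)) / Fintype.card G := by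
      intro γ
      rw [fourierSum, fourierSum, map_sum, Finset.sum_mul_sum, div_mul_eq_mul_div, Finset.sum_mul]
      congr 1
      refine Finset.sum_congr rfl fun x _ => ?_
      rw [Finset.sum_mul]
      refine Finset.sum_congr rfl fun y _ => ?_
      rw [map_mul, Complex.conj_ofReal, ← AddChar.map_neg_eq_conj, sub_eq_add_neg,
        AddChar.map_add_eq_mul, AddChar.map_add_eq_mul]
      ring
    simp_rw [e]
    rw [← Finset.sum_div, Finset.sum_comm, eq_div_iff (by exact_mod_cast hG.ne')]
    push_cast
    rw [Finset.sum_mul]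
    refine Finset.sum_congr rfl fun x _ => ?_
    rw [Finset.sum_comm]
    have e2 : ∀ y, (x - y + z = 0) ↔ x + z = y := fun y => by
      rw [sub_add_eq_add_sub, sub_eq_zero]
    simp_rw [← Finset.mul_sum, AddChar.sum_apply_eq_ite, e2]
    simp
  · have h1 := sum_norm_fourierSum_sq P
    have h2 := sum_norm_fourierSum_sq Q
    calc _ = (∑ γ, ‖fourierSum P γ‖ * ‖fourierSum Q γ‖) / Fintype.card G := by
          rw [Finset.sum_div]
          refine Finset.sum_congr rfl fun γ _ => ?_
          rw [norm_div, norm_mul, RCLike.norm_conj, Complex.norm_natCast]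
      _ ≤ (∑ γ, (‖fourierSum P γ‖ ^ 2 + ‖fourierSum Q γ‖ ^ 2) / 2) / Fintype.card G := by
          gcongr with γ
          nlinarith [sq_nonneg (‖fourierSum P γ‖ - ‖fourierSum Q γ‖)]
      _ = _ := by
          rw [← Finset.sum_div, Finset.sum_add_distrib, h1, h2]
          field_simp

theorem WienerBound.translate {f : G → ℝ} {L : ℝ} (hf : WienerBound f L) (a : G) :
    WienerBound (fun z => f (a + z)) L := by
  obtain ⟨c, h1, h2⟩ := hf
  refine ⟨fun γ => c γ * γ a, fun z => ?_, ?_⟩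
  · simp_rw [h1, AddChar.map_add_eq_mul, mul_assoc]
  · simpa only [norm_mul, AddChar.norm_apply, mul_one] using h2

theorem WienerBound.expect {ι : Type*} {s : Finset ι} (hs : s.Nonempty) {f : ι → G → ℝ} {L : ℝ}
    (hf : ∀ i ∈ s, WienerBound (f i) L) : WienerBound (fun z => 𝔼 i ∈ s, f i z) L := by
  choose! c h1 h2 using hf
  have hc : (0 : ℝ) < s.card := by exact_mod_cast hs.card_pos
  refine ⟨fun γ => (∑ i ∈ s, c i γ) / s.card, fun z => ?_, ?_⟩
  · simp only [div_mul_eq_mul_div, Finset.sum_mul]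
    rw [← Finset.sum_div, Finset.sum_comm, Finset.expect_eq_sum_div_card]
    push_cast
    congr 1
    exact Finset.sum_congr rfl fun i hi => h1 i hi z
  · simp only [norm_div, Complex.norm_natCast]
    rw [← Finset.sum_div, div_le_iff₀ hc]
    calc _ ≤ ∑ γ, ∑ i ∈ s, ‖c i γ‖ := Finset.sum_le_sum fun γ _ => norm_sum_le _ _
      _ = ∑ i ∈ s, ∑ γ, ‖c i γ‖ := Finset.sum_comm
      _ ≤ ∑ i ∈ s, L := Finset.sum_le_sum h2
      _ = L * s.card := by rw [Finset.sum_const, nsmul_eq_mul, mul_comm]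

theorem WienerBound.div {f : G → ℝ} {L : ℝ} (hf : WienerBound f L) {N : ℝ} (hN : 0 < N) :
    WienerBound (fun z => f z / N) (L / N) := by
  obtain ⟨c, h1, h2⟩ := hf
  refine ⟨fun γ => c γ / N, fun z => ?_, ?_⟩
  · push_cast
    rw [h1, Finset.sum_div]
    exact Finset.sum_congr rfl fun γ _ => by ring
  · simp only [norm_div, Complex.norm_real, Real.norm_eq_abs, abs_of_pos hN]
    rw [← Finset.sum_div]
    gcongr

theorem WienerBound.mono {f : G → ℝ} {L L' : ℝ} (hf : WienerBound f L) (h : L ≤ L') :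
    WienerBound f L' := by
  obtain ⟨c, h1, h2⟩ := hf
  exact ⟨c, h1, h2.trans h⟩

theorem diffAvg_iterate_eq (W : Finset G) (f : G → ℝ) (c : AddChar G ℂ → ℂ)
    (hf : ∀ z, (f z : ℂ) = ∑ γ, c γ * γ z) (k : ℕ) (z : G) :
    ((diffAvg W)^[k] f z : ℂ) = ∑ γ, c γ * (‖charMean W γ‖ : ℂ) ^ (2 * k) * γ z := by
  induction k generalizing z with
  | zero => simp [hf]
  | succ k ih =>
    rw [Function.iterate_succ_apply', diffAvg]
    have hm : ∀ γ : AddChar G ℂ, 𝔼 w ∈ W, 𝔼 w' ∈ W, γ (z + (w - w')) =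
        (‖charMean W γ‖ : ℂ) ^ 2 * γ z := by
      intro γ
      rw [← Complex.mul_conj', charMean, map_expect, Finset.expect_mul_expect, Finset.expect_mul]
      refine Finset.expect_congr rfl fun w _ => ?_
      rw [Finset.expect_mul]
      refine Finset.expect_congr rfl fun w' _ => ?_
      rw [← AddChar.map_neg_eq_conj, AddChar.map_add_eq_mul, sub_eq_add_neg,
        AddChar.map_add_eq_mul]
      ring
    have hcast : ((𝔼 w ∈ W, 𝔼 w' ∈ W, (diffAvg W)^[k] f (z + (w - w')) : ℝ) : ℂ) =
        𝔼 w ∈ W, 𝔼 w' ∈ W, ((diffAvg W)^[k] f (z + (w - w')) : ℂ) := by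
      simp_rw [Finset.expect_eq_sum_div_card]
      push_cast
      rfl
    rw [hcast]
    simp_rw [ih, Finset.expect_sum_comm, ← Finset.mul_expect, hm]
    refine Finset.sum_congr rfl fun γ _ => ?_
    ring

/-- Iterated averaging makes functions with bounded Wiener norm almost invariant in directions in
which every character in the large spectrum of `W` is almost trivial. -/
theorem abs_diffAvg_iterate_zero_sub_le (W : Finset G) {f : G → ℝ} {L : ℝ}
    (hf : WienerBound f L) (k : ℕ) (v : G) {η : ℝ}
    (hη : ∀ γ : AddChar G ℂ, ‖charMean W γ‖ ^ (2 * k) * ‖1 - γ v‖ ≤ η) :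
    |(diffAvg W)^[k] f 0 - (diffAvg W)^[k] f v| ≤ L * η := by
  obtain ⟨c, h1, h2⟩ := hf
  have hη0 : 0 ≤ η := le_trans (by positivity) (hη 0)
  have e : (((diffAvg W)^[k] f 0 - (diffAvg W)^[k] f v : ℝ) : ℂ) =
      ∑ γ, c γ * ((‖charMean W γ‖ : ℂ) ^ (2 * k) * (1 - γ v)) := by
    push_cast
    rw [diffAvg_iterate_eq W f c h1, diffAvg_iterate_eq W f c h1, ← Finset.sum_sub_distrib]
    refine Finset.sum_congr rfl fun γ _ => ?_
    rw [AddChar.map_zero_eq_one]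
    ring
  rw [← Real.norm_eq_abs, ← Complex.norm_real, e]
  refine (norm_sum_le _ _).trans ?_
  calc _ ≤ ∑ γ, ‖c γ‖ * η := by
        refine Finset.sum_le_sum fun γ _ => ?_
        rw [norm_mul, norm_mul, norm_pow, Complex.norm_real, norm_norm]
        exact mul_le_mul_of_nonneg_left (hη γ) (norm_nonneg _)
    _ ≤ _ := by rw [← Finset.sum_mul]; gcongr

end Fourier

section Chang
variable [AddCommGroup G]

/-- The unit complex number rotating the mean of `γ` over `W` to the positive reals. -/
def specPhase (W : Finset G) (γ : AddChar G ℂ) : ℂ :=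
  (starRingEnd ℂ) (charMean W γ) / ‖charMean W γ‖

theorem norm_specPhase_le (W : Finset G) (γ : AddChar G ℂ) : ‖specPhase W γ‖ ≤ 1 := by
  rw [specPhase, norm_div, RCLike.norm_conj, Complex.norm_real, norm_norm]
  exact div_self_le_one _

theorem expect_re_specPhase (W : Finset G) {γ : AddChar G ℂ} (hγ : 1 / 2 ≤ ‖charMean W γ‖) :
    𝔼 x ∈ W, (specPhase W γ * γ x).re = ‖charMean W γ‖ := by
  have h0 : (‖charMean W γ‖ : ℂ) ≠ 0 := by
    exact_mod_cast (show (0 : ℝ) < ‖charMean W γ‖ by linarith).ne'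
  have h1 : 𝔼 x ∈ W, specPhase W γ * γ x = ‖charMean W γ‖ := by
    rw [← Finset.mul_expect]
    change specPhase W γ * charMean W γ = _
    rw [specPhase, div_mul_eq_mul_div, Complex.conj_mul', sq, mul_div_cancel_right₀ _ h0]
  have h2 := congrArg Complex.re h1
  rw [Complex.ofReal_re] at h2
  rw [← h2, Finset.expect_eq_sum_div_card, Finset.expect_eq_sum_div_card,
    Complex.div_natCast_re, Complex.re_sum]

/-- Iterated averaging of `ν` over translates by elements of `U`. -/
def convIter (U : Finset G) (ν : G → ℝ) : ℕ → G → ℝ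
  | 0 => ν
  | n + 1 => fun z => 𝔼 u ∈ U, convIter U ν n (z - u)

theorem convIter_nonneg (U : Finset G) {ν : G → ℝ} (hν : ∀ x, 0 ≤ ν x) (n : ℕ) (x : G) :
    0 ≤ convIter U ν n x := by
  induction n generalizing x with
  | zero => exact hν x
  | succ n ih => exact Finset.expect_nonneg fun u _ => ih _

variable [Fintype G]

/-- The real function `1 + Re (ω γ) / 4`, where the phase `ω` aligns `γ` with `W`. -/
def rieszFactor (W : Finset G) (γ : AddChar G ℂ) (x : G) : ℝ :=
  1 + (specPhase W γ * γ x).re / 4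

/-- The Riesz-type product of the factors attached to a list of characters. -/
def rieszProd (W : Finset G) (Λ : List (AddChar G ℂ)) (x : G) : ℝ :=
  (Λ.map fun γ => rieszFactor W γ x).prod

theorem abs_re_specPhase_mul_le (W : Finset G) (γ : AddChar G ℂ) (x : G) :
    |(specPhase W γ * γ x).re| ≤ 1 := by
  refine (Complex.abs_re_le_norm _).trans ?_
  rw [norm_mul, AddChar.norm_apply, mul_one]
  exact norm_specPhase_le W γ

theorem three_quarters_le_rieszFactor (W : Finset G) (γ : AddChar G ℂ) (x : G) :
    3 / 4 ≤ rieszFactor W γ x := by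
  have := abs_le.1 (abs_re_specPhase_mul_le W γ x)
  rw [rieszFactor]
  linarith

theorem pow_le_rieszProd (W : Finset G) (Λ : List (AddChar G ℂ)) (x : G) :
    (3 / 4) ^ Λ.length ≤ rieszProd W Λ x := by
  induction Λ with
  | nil => simp [rieszProd]
  | cons γ Λ ih =>
    rw [rieszProd, List.map_cons, List.prod_cons, List.length_cons, pow_succ, mul_comm]
    have h1 := three_quarters_le_rieszFactor W γ x
    exact mul_le_mul h1 ih (by positivity) (by linarith)

theorem rieszProd_pos (W : Finset G) (Λ : List (AddChar G ℂ)) (x : G) : 0 < rieszProd W Λ x :=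
  lt_of_lt_of_le (by positivity) (pow_le_rieszProd W Λ x)

theorem le_expect_log_rieszProd {W : Finset G} (hW : W.Nonempty) (Λ : List (AddChar G ℂ))
    (hΛ : ∀ γ ∈ Λ, 1 / 2 ≤ ‖charMean W γ‖) :
    (Λ.length : ℝ) / 24 ≤ 𝔼 x ∈ W, Real.log (rieszProd W Λ x) := by
  induction Λ with
  | nil => simp [rieszProd]
  | cons γ Λ ih =>
    have h1 := ih fun γ hγ => hΛ γ (List.mem_cons_of_mem _ hγ)
    have hγ := hΛ γ List.mem_cons_self
    have h2 : ∀ x ∈ W, (specPhase W γ * γ x).re / 4 - 1 / 12 + Real.log (rieszProd W Λ x) ≤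
        Real.log (rieszProd W (γ :: Λ) x) := by
      intro x _
      have hf := three_quarters_le_rieszFactor W γ x
      have e : rieszProd W (γ :: Λ) x = rieszFactor W γ x * rieszProd W Λ x := by
        rw [rieszProd, List.map_cons, List.prod_cons]; rfl
      rw [e, Real.log_mul (by linarith) (rieszProd_pos W Λ x).ne', add_le_add_iff_right]
      have h3 := Real.one_sub_inv_le_log_of_pos (show 0 < rieszFactor W γ x by linarith)
      refine le_trans ?_ h3
      have habs := abs_le.1 (abs_re_specPhase_mul_le W γ x)
      rw [rieszFactor] at hf ⊢
      set u := (specPhase W γ * γ x).re / 4 with hu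
      have : 0 < 1 + u := by linarith
      rw [show 1 - (1 + u)⁻¹ = u / (1 + u) by field_simp; ring, le_div_iff₀ this]
      have h4 : u ≤ 1 / 4 := by linarith
      have h5 : -(1 / 4) ≤ u := by linarith
      nlinarith
    have h3 := Finset.expect_le_expect h2
    rw [Finset.expect_add_distrib, Finset.expect_sub_distrib, Finset.expect_const hW,
      ← Finset.expect_div, expect_re_specPhase W hγ] at h3
    rw [List.length_cons]
    push_cast
    linarith

theorem exp_expect_log_le {α : Type*} {W : Finset α} (hW : W.Nonempty) (g : α → ℝ)
    (hg : ∀ x ∈ W, 0 < g x) : Real.exp (𝔼 x ∈ W, Real.log (g x)) ≤ 𝔼 x ∈ W, g x := by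
  set a := 𝔼 x ∈ W, Real.log (g x) with ha
  have h : ∀ x ∈ W, Real.exp a * (1 + (Real.log (g x) - a)) ≤ g x := by
    intro x hx
    calc _ ≤ Real.exp a * Real.exp (Real.log (g x) - a) := by
          gcongr
          linarith [Real.add_one_le_exp (Real.log (g x) - a)]
      _ = g x := by rw [← Real.exp_add, add_sub_cancel, Real.exp_log (hg x hx)]
  have h2 := Finset.expect_le_expect h
  rw [← Finset.mul_expect, Finset.expect_add_distrib, Finset.expect_sub_distrib,
    Finset.expect_const hW, Finset.expect_const hW, ← ha] at h2
  simpa using h2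

theorem re_mul_le_of_norm_le {z ω : ℂ} (hω : ‖ω‖ ≤ 1) {c : ℝ} (hz : ‖z‖ ≤ c) :
    (ω * z).re ≤ c := by
  refine (Complex.re_le_norm _).trans ?_
  rw [norm_mul]
  exact (mul_le_of_le_one_left (norm_nonneg _) hω).trans hz

/-- A greedily chosen maximal dissociated list of large-spectrum characters. -/
theorem exists_maximal_rieszProd {W : Finset G} (hW : W.Nonempty) (ν : G → ℝ)
    (hν0 : ∀ x, 0 ≤ ν x) (hν1 : ∑ x, ν x = 1) {C : ℝ} (hC : 0 < C)
    (hνW : ∀ x ∈ W, 1 ≤ C * W.card * ν x) :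
    ∃ Λ : List (AddChar G ℂ), (Λ.length : ℝ) ≤ 40 * Real.log C ∧
      ∀ γ : AddChar G ℂ, 1 / 2 ≤ ‖charMean W γ‖ →
        (∑ x, ν x * rieszProd W Λ x) / 16 ≤ ‖∑ x, (ν x * rieszProd W Λ x : ℂ) * γ x‖ := by
  set Good : List (AddChar G ℂ) → Prop := fun Λ =>
    (∀ γ ∈ Λ, 1 / 2 ≤ ‖charMean W γ‖) ∧ ∑ x, ν x * rieszProd W Λ x ≤ (65 / 64) ^ Λ.length with hG
  have hlen : ∀ Λ, Good Λ → (Λ.length : ℝ) ≤ 40 * Real.log C := by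
    rintro Λ ⟨h1, h2⟩
    have h3 := le_expect_log_rieszProd hW Λ h1
    have h4 := exp_expect_log_le hW (rieszProd W Λ) fun x _ => rieszProd_pos W Λ x
    have hWc : (0 : ℝ) < W.card := by exact_mod_cast hW.card_pos
    have h5 : 𝔼 x ∈ W, rieszProd W Λ x ≤ C * ∑ x, ν x * rieszProd W Λ x := by
      rw [Finset.expect_eq_sum_div_card, div_le_iff₀ hWc]
      calc ∑ x ∈ W, rieszProd W Λ x ≤ ∑ x ∈ W, C * W.card * ν x * rieszProd W Λ x :=
            Finset.sum_le_sum fun x hx =>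
              le_mul_of_one_le_left (rieszProd_pos W Λ x).le (hνW x hx)
        _ ≤ ∑ x, C * W.card * ν x * rieszProd W Λ x :=
            Finset.sum_le_sum_of_subset_of_nonneg (Finset.subset_univ _) fun x _ _ =>
              mul_nonneg (mul_nonneg (by positivity) (hν0 x)) (rieszProd_pos W Λ x).le
        _ = _ := by
            rw [Finset.mul_sum, Finset.sum_mul]
            exact Finset.sum_congr rfl fun x _ => by ring
    have h6 : (65 / 64 : ℝ) ^ Λ.length ≤ Real.exp (Λ.length / 64) := by
      rw [show (Λ.length : ℝ) / 64 = Λ.length * (1 / 64) by ring, Real.exp_nat_mul]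
      refine pow_le_pow_left₀ (by norm_num) ?_ _
      linarith [Real.add_one_le_exp (1 / 64 : ℝ)]
    have h7 : Real.exp (Λ.length / 24) ≤ Real.exp (Real.log C + Λ.length / 64) := by
      rw [Real.exp_add, Real.exp_log hC]
      calc _ ≤ _ := Real.exp_le_exp.2 h3
        _ ≤ _ := h4
        _ ≤ _ := h5
        _ ≤ _ := by gcongr; exact h2.trans h6
    have h8 := Real.exp_le_exp.1 h7
    have h9 : (0 : ℝ) ≤ Λ.length := Nat.cast_nonneg _
    linarith
  by_contra! hcon
  have hall : ∀ n : ℕ, ∃ Λ, Good Λ ∧ Λ.length = n := by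
    intro n
    induction n with
    | zero => exact ⟨[], ⟨by simp, by simp [rieszProd, hν1]⟩, rfl⟩
    | succ n ih =>
      obtain ⟨Λ, hΛ, rfl⟩ := ih
      obtain ⟨γ, hγ, hlt⟩ := hcon Λ (hlen Λ hΛ)
      refine ⟨γ :: Λ, ⟨?_, ?_⟩, rfl⟩
      · intro γ' h
        rcases List.mem_cons.1 h with rfl | h
        · exact hγ
        · exact hΛ.1 _ h
      · have e : ∑ x, ν x * rieszProd W (γ :: Λ) x = ∑ x, ν x * rieszProd W Λ x +
            (specPhase W γ * ∑ x, (ν x * rieszProd W Λ x : ℂ) * γ x).re / 4 := by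
          rw [Finset.mul_sum, Complex.re_sum, Finset.sum_div, ← Finset.sum_add_distrib]
          refine Finset.sum_congr rfl fun x _ => ?_
          have e1 : rieszProd W (γ :: Λ) x = rieszFactor W γ x * rieszProd W Λ x := by
            rw [rieszProd, List.map_cons, List.prod_cons]; rfl
          have e2 : specPhase W γ * ((ν x * rieszProd W Λ x : ℂ) * γ x) =
              ((ν x * rieszProd W Λ x : ℝ) : ℂ) * (specPhase W γ * γ x) := by push_cast; ring
          rw [e1, e2, Complex.re_ofReal_mul, rieszFactor]
          ring
        have h1 := re_mul_le_of_norm_le (norm_specPhase_le W γ) hlt.le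
        rw [e, List.length_cons, pow_succ]
        have := hΛ.2
        linarith
  obtain ⟨n, hn⟩ := exists_nat_gt (40 * Real.log C)
  obtain ⟨Λ, hΛ, rfl⟩ := hall n
  exact absurd (hlen Λ hΛ) (not_le.2 hn)

/-- Expanding a Riesz product: some character in the span of the list has a large coefficient. -/
theorem exists_char_of_large_rieszProd (W : Finset G) (ν : G → ℝ) (Λ : List (AddChar G ℂ))
    (γ : AddChar G ℂ) :
    ∃ χ : AddChar G ℂ,
      ‖∑ x, (ν x * rieszProd W Λ x : ℂ) * γ x‖ ≤ (5 / 4) ^ Λ.length * ‖∑ x, (ν x : ℂ) * χ x‖ ∧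
      ∀ v, ‖1 - γ v‖ ≤ ‖1 - χ v‖ + (Λ.map fun l => ‖1 - l v‖).sum := by
  induction Λ generalizing γ with
  | nil => exact ⟨γ, by simp [rieszProd], by simp⟩
  | cons l Λ ih =>
    set F : AddChar G ℂ → ℂ := fun χ => ∑ x, (ν x * rieszProd W Λ x : ℂ) * χ x with hF
    set ω := specPhase W l with hω
    have hωn : ‖ω‖ ≤ 1 := norm_specPhase_le W l
    have e : ∑ x, (ν x * rieszProd W (l :: Λ) x : ℂ) * γ x =
        F γ + ω / 8 * F (γ * l) + (starRingEnd ℂ) ω / 8 * F (γ * l⁻¹) := by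
      simp only [hF, Finset.mul_sum, ← Finset.sum_add_distrib]
      refine Finset.sum_congr rfl fun x _ => ?_
      have e1 : rieszProd W (l :: Λ) x = rieszFactor W l x * rieszProd W Λ x := by
        rw [rieszProd, List.map_cons, List.prod_cons]; rfl
      have e2 : ((rieszFactor W l x : ℝ) : ℂ) =
          1 + (ω * l x + (starRingEnd ℂ) ω * l (-x)) / 8 := by
        rw [rieszFactor]
        push_cast
        rw [Complex.re_eq_add_conj, map_mul, ← AddChar.map_neg_eq_conj]
        ring
      rw [e1, AddChar.mul_apply, AddChar.mul_apply, AddChar.inv_apply]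
      push_cast
      rw [e2]
      ring
    have hmax : ∃ χ, (χ = γ ∨ χ = γ * l ∨ χ = γ * l⁻¹) ∧
        ‖F γ‖ ≤ ‖F χ‖ ∧ ‖F (γ * l)‖ ≤ ‖F χ‖ ∧ ‖F (γ * l⁻¹)‖ ≤ ‖F χ‖ := by
      rcases le_total ‖F γ‖ ‖F (γ * l)‖ with h1 | h1 <;>
      rcases le_total ‖F γ‖ ‖F (γ * l⁻¹)‖ with h2 | h2 <;>
      rcases le_total ‖F (γ * l)‖ ‖F (γ * l⁻¹)‖ with h3 | h3 <;>
      first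
      | exact ⟨γ, by simp, by grind⟩
      | exact ⟨γ * l, by simp, by grind⟩
      | exact ⟨γ * l⁻¹, by simp, by grind⟩
    obtain ⟨γ', hγ', m1, m2, m3⟩ := hmax
    obtain ⟨χ, h1, h2⟩ := ih γ'
    refine ⟨χ, ?_, fun v => ?_⟩
    · rw [e]
      have hb : ‖F γ + ω / 8 * F (γ * l) + (starRingEnd ℂ) ω / 8 * F (γ * l⁻¹)‖ ≤
          5 / 4 * ‖F γ'‖ := by
        have n1 : ‖ω / 8 * F (γ * l)‖ ≤ 1 / 8 * ‖F γ'‖ := by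
          rw [norm_mul, norm_div]
          norm_num
          gcongr
        have n2 : ‖(starRingEnd ℂ) ω / 8 * F (γ * l⁻¹)‖ ≤ 1 / 8 * ‖F γ'‖ := by
          rw [norm_mul, norm_div, RCLike.norm_conj]
          norm_num
          gcongr
        have := norm_add₃_le (a := F γ) (b := ω / 8 * F (γ * l))
          (c := (starRingEnd ℂ) ω / 8 * F (γ * l⁻¹))
        linarith
      refine hb.trans ?_
      rw [List.length_cons, pow_succ]
      linarith
    · have h3 := h2 v
      rw [List.map_cons, List.sum_cons]
      have h4 : ‖1 - γ v‖ ≤ ‖1 - γ' v‖ + ‖1 - l v‖ := by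
        rw [← norm_neg (1 - γ' v), ← norm_neg (1 - γ v), neg_sub, neg_sub]
        rcases hγ' with rfl | rfl | rfl
        · linarith [norm_nonneg (1 - l v)]
        · rw [AddChar.mul_apply, show γ v - 1 = (γ v * l v - 1) + γ v * (1 - l v) by ring]
          refine (norm_add_le _ _).trans ?_
          rw [norm_mul (γ v) (1 - l v), AddChar.norm_apply, one_mul]
        · rw [AddChar.mul_apply, AddChar.inv_apply,
            show γ v - 1 = (γ v * l (-v) - 1) + γ v * (1 - l (-v)) by ring]
          refine (norm_add_le _ _).trans ?_
          rw [norm_mul (γ v) (1 - l (-v)), AddChar.norm_apply, one_mul, norm_one_sub_char_neg]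
      linarith

theorem sum_convIter {U : Finset G} (ν : G → ℝ) (n : ℕ) (χ : AddChar G ℂ) :
    ∑ x, (convIter U ν n x : ℂ) * χ x = charMean U χ ^ n * ∑ x, (ν x : ℂ) * χ x := by
  induction n with
  | zero => simp [convIter]
  | succ n ih =>
    have e : ∀ x, (convIter U ν (n + 1) x : ℂ) * χ x =
        𝔼 u ∈ U, χ u * ((convIter U ν n (x - u) : ℂ) * χ (x - u)) := by
      intro x
      simp only [convIter, Finset.expect_eq_sum_div_card]
      push_cast
      rw [div_mul_eq_mul_div, Finset.sum_mul]
      congr 1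
      refine Finset.sum_congr rfl fun u _ => ?_
      conv_lhs => rw [show x = u + (x - u) by abel, AddChar.map_add_eq_mul]
      simp only [add_sub_cancel]
      ring
    simp_rw [e]
    rw [← Finset.expect_sum_comm]
    have e2 : ∀ u, ∑ x, χ u * ((convIter U ν n (x - u) : ℂ) * χ (x - u)) =
        χ u * (charMean U χ ^ n * ∑ x, (ν x : ℂ) * χ x) := by
      intro u
      rw [← Finset.mul_sum, ← ih]
      congr 1
      exact Fintype.sum_equiv (Equiv.subRight u) _ _ fun x => rfl
    simp_rw [e2]
    rw [← Finset.expect_mul, pow_succ]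
    change charMean U χ * _ = _
    ring

theorem sum_convIter_eq {U : Finset G} (hU : U.Nonempty) (ν : G → ℝ) (n : ℕ) :
    ∑ x, convIter U ν n x = ∑ x, ν x := by
  have h := sum_convIter (U := U) ν n 0
  have h1 : charMean U 0 = 1 := by
    rw [charMean]
    simp only [AddChar.zero_apply]
    exact Finset.expect_const hU _
  rw [h1] at h
  simp only [AddChar.zero_apply, mul_one, one_pow, one_mul] at h
  exact_mod_cast h

/-- Relative Chang theorem: the large spectrum of a dense subset of a regular Bohr set is
controlled, on a smaller Bohr set, by few additional characters. -/
theorem relative_chang {w : AddChar G ℂ → ℝ} (hw : ∀ γ, 0 ≤ w γ) {r η r' η' : ℝ}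
    (hr : 0 ≤ r) (hη : 0 ≤ η) (hr' : 0 ≤ r') (hη' : 0 ≤ η') {ε : ℝ}
    (hreg : ((wbohr w (r + η)).card : ℝ) ≤ 2 * (wbohr w r).card)
    (hreg' : ((wbohr w (r' + η')).card : ℝ) ≤ (1 + ε) * (wbohr w r').card)
    {W : Finset G} (hW : W.Nonempty) (hWr : W ⊆ wbohr w r) {τ : ℝ} (hτ : 0 < τ)
    (hWτ : τ * (wbohr w r).card ≤ W.card) {n : ℕ} (hn : 40 * Real.log (2 / τ) ≤ n)
    (hnr : (n + 4) * r' ≤ η) :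
    ∃ Λ : Finset (AddChar G ℂ), Λ.card ≤ n ∧ ∀ γ : AddChar G ℂ, 1 / 2 ≤ ‖charMean W γ‖ →
      ∀ v ∈ wbohr w η', ∀ ρ : ℝ, 0 ≤ ρ → (∀ l ∈ Λ, ‖1 - l v‖ ≤ ρ) →
        ‖1 - γ v‖ ≤ 4 * ε + n * ρ := by
  set Vp := wbohr w (r + η) with hVp
  set U := wbohr w r' with hU
  have hUne : U.Nonempty := wbohr_nonempty w hr'
  have hVpne : Vp.Nonempty := wbohr_nonempty w (by linarith)
  have hVc : (0 : ℝ) < Vp.card := by exact_mod_cast hVpne.card_pos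
  set ν₀ : G → ℝ := fun x => if x ∈ Vp then (Vp.card : ℝ)⁻¹ else 0 with hν₀
  have hν₀0 : ∀ x, 0 ≤ ν₀ x := fun x => by simp only [hν₀]; split_ifs <;> positivity
  have hν₀1 : ∑ x, ν₀ x = 1 := by simp [hν₀, hVc.ne']
  set ν := convIter U ν₀ (n + 4) with hν
  have hval : ∀ j : ℕ, ∀ x σ, x ∈ wbohr w σ → σ + j * r' ≤ r + η →
      convIter U ν₀ j x = (Vp.card : ℝ)⁻¹ := by
    intro j
    induction j with
    | zero =>
      intro x σ hx hσ
      simp only [convIter, hν₀]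
      rw [if_pos (wbohr_mono w (by simpa using hσ) hx)]
    | succ j ih =>
      intro x σ hx hσ
      push_cast at hσ
      simp only [convIter]
      rw [Finset.expect_congr rfl fun u hu => ih (x - u) (σ + r')
        (sub_mem_wbohr hw hx hu le_rfl) (by linarith), Finset.expect_const hUne]
  have hνW : ∀ x ∈ W, 1 ≤ 2 / τ * W.card * ν x := by
    intro x hx
    rw [hν, hval (n + 4) x r (hWr hx) (by push_cast; linarith), ← div_eq_mul_inv,
      le_div_iff₀ hVc, one_mul, div_mul_eq_mul_div, le_div_iff₀ hτ]
    nlinarith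
  obtain ⟨Λ, hΛ, hspec⟩ := exists_maximal_rieszProd hW ν (convIter_nonneg U hν₀0 _)
    ((sum_convIter_eq hUne ν₀ _).trans hν₀1) (by positivity : (0 : ℝ) < 2 / τ) hνW
  have hΛn : Λ.length ≤ n := by exact_mod_cast hΛ.trans hn
  refine ⟨Λ.toFinset, (List.toFinset_card_le _).trans hΛn, fun γ hγ v hv ρ hρ0 hρ => ?_⟩
  obtain ⟨χ, h1, h2⟩ := exists_char_of_large_rieszProd W ν Λ γ
  have h3 := (hspec γ hγ).trans h1
  have h4 : (3 / 4) ^ Λ.length ≤ ∑ x, ν x * rieszProd W Λ x := by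
    calc (3 / 4 : ℝ) ^ Λ.length = ∑ x, ν x * (3 / 4) ^ Λ.length := by
          rw [← Finset.sum_mul, hν, sum_convIter_eq hUne, hν₀1, one_mul]
      _ ≤ _ := Finset.sum_le_sum fun x _ =>
          mul_le_mul_of_nonneg_left (pow_le_rieszProd W Λ x) (convIter_nonneg U hν₀0 _ _)
  have h5 : ‖∑ x, (ν x : ℂ) * χ x‖ ≤ ‖charMean U χ‖ ^ (n + 4) := by
    rw [hν, sum_convIter, norm_mul, norm_pow]
    refine mul_le_of_le_one_right (by positivity) ?_
    refine (norm_sum_le _ _).trans ?_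
    simp only [norm_mul, AddChar.norm_apply, mul_one, Complex.norm_real, Real.norm_eq_abs]
    rw [Finset.sum_congr rfl fun x _ => abs_of_nonneg (hν₀0 x), hν₀1]
  have h6 : (1 / 2 : ℝ) ^ (n + 4) ≤ ‖charMean U χ‖ ^ (n + 4) := by
    refine le_trans ?_ h5
    have e1 : (3 / 4 : ℝ) ^ Λ.length / 16 ≤ (5 / 4) ^ Λ.length * ‖∑ x, (ν x : ℂ) * χ x‖ := by
      linarith
    have e2 : (3 / 4 : ℝ) ^ Λ.length = (5 / 4) ^ Λ.length * (3 / 5) ^ Λ.length := by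
      rw [← mul_pow]; norm_num
    rw [e2, mul_div_assoc] at e1
    refine le_trans ?_ (le_of_mul_le_mul_left e1 (by positivity))
    have e3 : (1 / 2 : ℝ) ^ n ≤ (3 / 5) ^ Λ.length :=
      (pow_le_pow_of_le_one (by norm_num) (by norm_num) hΛn).trans
        (pow_le_pow_left₀ (by norm_num) (by norm_num) _)
    rw [pow_add]
    norm_num at e3 ⊢
    linarith
  have h7 : 1 / 2 ≤ ‖charMean U χ‖ :=
    (pow_le_pow_iff_left₀ (by norm_num) (norm_nonneg _) (by omega)).1 h6
  have h8 := norm_expect_shift_sub_le hw hr' hη' hreg' hv (fun x => χ x) (C := 1)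
    fun x => (AddChar.norm_apply χ x).le
  have h9 : 𝔼 x ∈ U, χ (x + v) = charMean U χ * χ v := by
    simp_rw [AddChar.map_add_eq_mul, ← Finset.expect_mul]; rfl
  have h10 : ‖1 - χ v‖ ≤ 4 * ε := by
    have e : charMean U χ * χ v - charMean U χ = -(charMean U χ * (1 - χ v)) := by ring
    rw [h9] at h8
    change ‖charMean U χ * χ v - charMean U χ‖ ≤ _ at h8
    rw [e, norm_neg, norm_mul] at h8
    nlinarith [norm_nonneg (1 - χ v)]
  have h11 : (Λ.map fun l => ‖1 - l v‖).sum ≤ n * ρ := by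
    calc _ ≤ (Λ.map fun l => ‖1 - l v‖).length • ρ := by
          refine List.sum_le_card_nsmul _ _ fun x hx => ?_
          obtain ⟨l, hl, rfl⟩ := List.mem_map.1 hx
          exact hρ l (List.mem_toFinset.2 hl)
      _ ≤ _ := by
          rw [List.length_map, nsmul_eq_mul]
          gcongr
  linarith [h2 v]

end Chang

section Columns

theorem expect_nonneg_le_one {ι : Type*} (s : Finset ι) {f : ι → ℝ} (h0 : ∀ i ∈ s, 0 ≤ f i)
    (h1 : ∀ i ∈ s, f i ≤ 1) : 0 ≤ 𝔼 i ∈ s, f i ∧ 𝔼 i ∈ s, f i ≤ 1 := by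
  refine ⟨Finset.expect_nonneg h0, ?_⟩
  rcases s.eq_empty_or_nonempty with rfl | hs
  · simp
  · exact (Finset.expect_le_expect h1).trans (Finset.expect_const hs _).le

/-- The density of the column of `A` above `x` inside `V`. -/
def colAvg (A : Set (G × G)) (V : Finset G) (x : G) : ℝ :=
  𝔼 v ∈ V, if (x, v) ∈ A then (1 : ℝ) else 0

theorem colAvg_nonneg (A : Set (G × G)) (V : Finset G) (x : G) : 0 ≤ colAvg A V x :=
  (expect_nonneg_le_one V (fun _ _ => by split_ifs <;> norm_num)
    fun _ _ => by split_ifs <;> norm_num).1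

theorem colAvg_le_one (A : Set (G × G)) (V : Finset G) (x : G) : colAvg A V x ≤ 1 :=
  (expect_nonneg_le_one V (fun _ _ => by split_ifs <;> norm_num)
    fun _ _ => by split_ifs <;> norm_num).2

theorem exists_mem_of_colAvg_pos {A : Set (G × G)} {V : Finset G} {x : G}
    (h : 0 < colAvg A V x) : ∃ v, (x, v) ∈ A := by
  by_contra! hcon
  simp [colAvg, hcon] at h

theorem abs_correlation_sub_le {V' V : Finset G} (hV' : V'.Nonempty) (hV : V.Nonempty) (a : G → ℝ)
    (ha0 : ∀ ξ, 0 ≤ a ξ) (ha1 : ∀ ξ, a ξ ≤ 1) (F₁ F₂ : G × G → ℝ) {ε : ℝ}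
    (h₁ : ∀ ξ ∈ V', |𝔼 v ∈ V, F₁ (ξ, v) - a ξ| ≤ ε)
    (h₂ : ∀ ξ ∈ V', |𝔼 v ∈ V, F₂ (ξ, v) - a ξ| ≤ ε) :
    |𝔼 ω ∈ V' ×ˢ V, F₁ ω * F₂ ω -
      (𝔼 ξ ∈ V', a ξ ^ 2 + 𝔼 ω ∈ V' ×ˢ V, (F₁ ω - a ω.1) * (F₂ ω - a ω.1))| ≤ 2 * ε := by
  rw [Finset.expect_product, Finset.expect_product, ← Finset.expect_add_distrib,
    ← Finset.expect_sub_distrib]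
  have key : ∀ ξ, 𝔼 v ∈ V, F₁ (ξ, v) * F₂ (ξ, v) -
      (a ξ ^ 2 + 𝔼 v ∈ V, (F₁ (ξ, v) - a ξ) * (F₂ (ξ, v) - a ξ)) =
      a ξ * (𝔼 v ∈ V, F₁ (ξ, v) - a ξ) + a ξ * (𝔼 v ∈ V, F₂ (ξ, v) - a ξ) := by
    intro ξ
    have e : ∀ v, (F₁ (ξ, v) - a ξ) * (F₂ (ξ, v) - a ξ) =
        F₁ (ξ, v) * F₂ (ξ, v) - a ξ * F₁ (ξ, v) - a ξ * F₂ (ξ, v) + a ξ ^ 2 := fun v => by ring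
    simp_rw [e, Finset.expect_add_distrib, Finset.expect_sub_distrib, ← Finset.mul_expect,
      Finset.expect_const hV]
    ring
  simp_rw [key]
  refine (Finset.abs_expect_le _ _).trans (Finset.expect_le hV' fun ξ hξ => ?_)
  have b1 := h₁ ξ hξ
  have b2 := h₂ ξ hξ
  rw [abs_le] at *
  have := ha0 ξ
  have := ha1 ξ
  constructor <;> nlinarith

variable [AddCommGroup G]

/-- The set obtained from `A` by a horizontal translation and a translation of each column. -/
def shear (A : Set (G × G)) (t : G) (c : G → G) : Set (G × G) :=
  {p | (t + p.1, c p.1 + p.2) ∈ A}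

theorem IsSkewCornerFree.shear {A : Set (G × G)} (hA : IsSkewCornerFree A) (t : G) (c : G → G) :
    IsSkewCornerFree (shear A t c) := by
  intro x y y' h h1 h2 h3
  refine hA (t + x) (c x + y) (c (x + h) + y') h h1 ?_ ?_
  · simpa only [SkewPaper.shear, Set.mem_ofPred_eq, add_assoc] using h2
  · simpa only [SkewPaper.shear, Set.mem_ofPred_eq, add_assoc] using h3

/-- The indicator of the column of `A` above `ξ`, cut off to `U` and translated by `σ ξ`. -/
def colInd (A : Set (G × G)) (U : Finset G) (σ : G → G) (ξ y : G) : ℝ :=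
  if y + σ ξ ∈ U ∧ (ξ, y + σ ξ) ∈ A then 1 else 0

theorem colInd_eq_zero_or_one (A : Set (G × G)) (U : Finset G) (σ : G → G) (ξ y : G) :
    colInd A U σ ξ y = 0 ∨ colInd A U σ ξ y = 1 := by
  unfold colInd; split_ifs <;> simp

theorem colInd_nonneg (A : Set (G × G)) (U : Finset G) (σ : G → G) (ξ y : G) :
    0 ≤ colInd A U σ ξ y := by
  unfold colInd; split_ifs <;> simp

theorem colInd_le_one (A : Set (G × G)) (U : Finset G) (σ : G → G) (ξ y : G) :
    colInd A U σ ξ y ≤ 1 := by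
  unfold colInd; split_ifs <;> simp

theorem colInd_mul_colInd_eq_zero {A : Set (G × G)} (hA : IsSkewCornerFree A) (U : Finset G)
    {u s t y' ξ : G} (hy : (u + (s - t), y') ∈ A) (hξ : ξ ≠ u + (s - t)) (v : G) :
    colInd A U (fun _ => u) ξ (v + s) * colInd A U (fun x => x) ξ (v + t) = 0 := by
  by_contra hne
  have h1 : (ξ, v + s + u) ∈ A := by
    by_contra h
    simp [colInd, h] at hne
  have h2 : (ξ, v + t + ξ) ∈ A := by
    by_contra h
    simp [colInd, h] at hne
  refine hξ ?_
  have h := hA ξ (v + t + ξ) y' (u + (s - t) - ξ) h2 (by convert h1 using 2; abel)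
    (by convert hy using 2; abel)
  exact (sub_eq_zero.1 h).symm

end Columns

section Structure
variable [AddCommGroup G] [Fintype G]

theorem exists_shift_expect_ge {w : AddChar G ℂ → ℝ} (hw : ∀ γ, 0 ≤ w γ) {r η ε : ℝ} (hr : 0 ≤ r)
    (hη : 0 ≤ η) (hreg : ((wbohr w (r + η)).card : ℝ) ≤ (1 + ε) * (wbohr w r).card)
    {ι : Type*} {I : Finset ι} (hI : I.Nonempty) (τ : ι → G) (hτ : ∀ i ∈ I, τ i ∈ wbohr w η)
    (g : G → ℝ) (hg0 : ∀ x, 0 ≤ g x) (hg1 : ∀ x, g x ≤ 1) :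
    ∃ u ∈ wbohr w r, 𝔼 v ∈ wbohr w r, g v - ε ≤ 𝔼 i ∈ I, g (u + τ i) := by
  refine Finset.exists_le_of_le_expect (wbohr_nonempty w hr) ?_
  rw [Finset.expect_comm]
  refine Finset.le_expect hI fun i hi => ?_
  linarith [(abs_le.1 (abs_expect_shift_sub_le hw hr hη hreg (hτ i hi) g hg0 hg1)).1]

theorem abs_expect_colInd_sub_le {w : AddChar G ℂ → ℝ} (hw : ∀ γ, 0 ≤ w γ) {r η ε : ℝ}
    (hr : 0 ≤ r) (hη : 0 ≤ η)
    (hreg : ((wbohr w (r + η)).card : ℝ) ≤ (1 + ε) * (wbohr w r).card)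
    (A : Set (G × G)) (σ : G → G) {ξ s : G} (hs : s + σ ξ ∈ wbohr w η) :
    |𝔼 v ∈ wbohr w r, colInd A (wbohr w (r + η)) σ ξ (v + s) - colAvg A (wbohr w r) ξ| ≤ ε := by
  have h := abs_expect_shift_sub_le hw hr hη hreg hs
    (fun y => colInd A (wbohr w (r + η)) (fun _ => 0) ξ y)
    (fun y => colInd_nonneg _ _ _ _ _) (fun y => colInd_le_one _ _ _ _ _)
  have e1 : 𝔼 v ∈ wbohr w r, colInd A (wbohr w (r + η)) (fun _ => 0) ξ v =
      colAvg A (wbohr w r) ξ := by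
    refine Finset.expect_congr rfl fun v hv => ?_
    have : v ∈ wbohr w (r + η) := wbohr_mono w (by linarith) hv
    simp [colInd, this]
  rw [e1] at h
  simpa only [colInd, add_zero, ← add_assoc] using h

theorem exists_structured_pairs {A : Set (G × G)} (hA : IsSkewCornerFree A)
    {w : AddChar G ℂ → ℝ} (hw : ∀ γ, 0 ≤ w γ) {r η r₁ η₁ r₂ ε m : ℝ}
    (hr : 0 ≤ r) (hη : 0 ≤ η) (hr₁ : 0 ≤ r₁) (hη₁ : 0 ≤ η₁) (hr₂ : 0 ≤ r₂)
    (hreg : ((wbohr w (r + η)).card : ℝ) ≤ (1 + ε) * (wbohr w r).card)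
    (hreg₁ : ((wbohr w (r₁ + η₁)).card : ℝ) ≤ (1 + ε) * (wbohr w r₁).card)
    (h₁ : r₁ + r₂ ≤ η) (h₂ : r₂ + r₂ ≤ η₁)
    (hm : 𝔼 ξ ∈ wbohr w r₁, colAvg A (wbohr w r) ξ ^ 2 = m) (hm0 : 0 < m)
    (hε : 2000 * ε ≤ m) (hcard : ((wbohr w r₁).card : ℝ)⁻¹ ≤ ε)
    {p : ℕ} (hp : Even p) (hp18 : 18 ≤ p) (hpm : 1 ≤ (9 / 5 : ℝ) ^ p * (m / 2)) :
    ∃ σ : G → G, (∀ ξ ∈ wbohr w r₁, σ ξ ∈ wbohr w r₁) ∧ ∃ X ⊆ wbohr w r₂,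
      m ^ (4 * p) * (wbohr w r₂).card ≤ X.card ∧
      99 / 100 ≤ 𝔼 s ∈ X, 𝔼 s' ∈ X,
        if 11 / 10 * m ≤ 𝔼 ω ∈ wbohr w r₁ ×ˢ wbohr w r,
          colInd A (wbohr w (r + η)) σ ω.1 (ω.2 + s) *
          colInd A (wbohr w (r + η)) σ ω.1 (ω.2 + s') then (1 : ℝ) else 0 := by
  set V := wbohr w r with hV
  set V' := wbohr w r₁ with hV'
  set X := wbohr w r₂ with hX
  set U := wbohr w (r + η) with hU
  set a := colAvg A V with ha
  have hVne : V.Nonempty := wbohr_nonempty w hr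
  have hV'ne : V'.Nonempty := wbohr_nonempty w hr₁
  have hXne : X.Nonempty := wbohr_nonempty w hr₂
  have hε0 : 0 ≤ ε := le_trans (by positivity) hcard
  have ha0 : ∀ x, 0 ≤ a x := colAvg_nonneg A V
  have ha1 : ∀ x, a x ≤ 1 := colAvg_le_one A V
  obtain ⟨u, hu, hau⟩ := exists_shift_expect_ge hw hr₁ hη₁ hreg₁ (hXne.product hXne)
    (fun i => i.1 - i.2) (fun i hi => by
      rw [Finset.mem_product] at hi
      exact sub_mem_wbohr hw hi.1 hi.2 h₂)
    (fun x => a x ^ 2) (fun x => sq_nonneg _) (fun x => pow_le_one₀ (ha0 x) (ha1 x))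
  rw [hm, Finset.expect_product] at hau
  have hP : m / 2 ≤ 𝔼 s ∈ X, 𝔼 t ∈ X, if 0 < a (u + (s - t)) then (1 : ℝ) else 0 := by
    refine le_trans (by linarith) (hau.trans ?_)
    refine Finset.expect_le_expect fun s _ => Finset.expect_le_expect fun t _ => ?_
    split_ifs with h
    · exact pow_le_one₀ (ha0 _) (ha1 _)
    · have : a (u + (s - t)) = 0 := le_antisymm (not_lt.1 h) (ha0 _)
      simp [this]
  have happ : ∀ σ : G → G, (∀ ξ ∈ V', σ ξ ∈ V') → ∀ s ∈ X, ∀ ξ ∈ V',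
      |𝔼 v ∈ V, colInd A U σ ξ (v + s) - a ξ| ≤ ε := fun σ hσ s hs ξ hξ =>
    abs_expect_colInd_sub_le hw hr hη hreg A σ (add_mem_wbohr hw hs (hσ ξ hξ) (by linarith))
  have hfin : ∀ σ : G → G, (∀ ξ ∈ V', σ ξ ∈ V') →
      (m / 2) ^ p ≤ 𝔼 s ∈ X, 𝔼 s' ∈ X, (𝔼 ω ∈ V' ×ˢ V, (colInd A U σ ω.1 (ω.2 + s) - a ω.1) *
        (colInd A U σ ω.1 (ω.2 + s') - a ω.1)) ^ p →
      ∃ Y ⊆ X, m ^ (4 * p) * X.card ≤ Y.card ∧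
        99 / 100 ≤ 𝔼 s ∈ Y, 𝔼 s' ∈ Y,
          if 11 / 10 * m ≤ 𝔼 ω ∈ V' ×ˢ V, colInd A U σ ω.1 (ω.2 + s) *
            colInd A U σ ω.1 (ω.2 + s') then (1 : ℝ) else 0 := by
    intro σ hσ h
    have hn : ∀ s ∈ X, ∀ s' ∈ X,
        |𝔼 ω ∈ V' ×ˢ V, colInd A U σ ω.1 (ω.2 + s) * colInd A U σ ω.1 (ω.2 + s') -
          (m + 𝔼 ω ∈ V' ×ˢ V, (colInd A U σ ω.1 (ω.2 + s) - a ω.1) *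
            (colInd A U σ ω.1 (ω.2 + s') - a ω.1))| ≤ m / 1000 := fun s hs s' hs' => by
      have := abs_correlation_sub_le hV'ne hVne a ha0 ha1
        (fun ω => colInd A U σ ω.1 (ω.2 + s))
        (fun ω => colInd A U σ ω.1 (ω.2 + s')) (happ σ hσ s hs) (happ σ hσ s' hs')
      rw [hm] at this
      exact this.trans (by linarith)
    have hmom := expect_moment_lower_bound hXne (V' ×ˢ V)
      (fun s ω => colInd A U σ ω.1 (ω.2 + s)) (fun s ω => colInd A U σ ω.1 (ω.2 + s) - a ω.1)
      (fun s ω => colInd_nonneg _ _ _ _ _) (by omega) hm0 hn h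
    exact sift hXne (hV'ne.product hVne) (fun s ω => colInd A U σ ω.1 (ω.2 + s))
      (fun s ω => colInd_eq_zero_or_one _ _ _ _ _) hp18 hm0 hmom
  have hσ₁ : ∀ ξ ∈ V', (fun _ : G => u) ξ ∈ V' := fun _ _ => hu
  have hσ₂ : ∀ ξ ∈ V', (fun ξ : G => ξ) ξ ∈ V' := fun _ h => h
  have hneg : ∀ s ∈ X, ∀ t ∈ X, 0 < a (u + (s - t)) →
      𝔼 ω ∈ V' ×ˢ V, (colInd A U (fun _ => u) ω.1 (ω.2 + s) - a ω.1) *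
        (colInd A U (fun ξ => ξ) ω.1 (ω.2 + t) - a ω.1) ≤ -(9 / 10 * m) := by
    intro s hs t ht hst
    have h := abs_correlation_sub_le hV'ne hVne a ha0 ha1
      (fun ω => colInd A U (fun _ => u) ω.1 (ω.2 + s))
      (fun ω => colInd A U (fun ξ => ξ) ω.1 (ω.2 + t)) (happ _ hσ₁ s hs) (happ _ hσ₂ t ht)
    rw [hm] at h
    have hsmall : 𝔼 ω ∈ V' ×ˢ V, colInd A U (fun _ => u) ω.1 (ω.2 + s) *
        colInd A U (fun ξ => ξ) ω.1 (ω.2 + t) ≤ (V'.card : ℝ)⁻¹ := by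
      rw [Finset.expect_product, Finset.expect_eq_sum_div_card, div_eq_mul_inv]
      refine mul_le_of_le_one_left (by positivity) ?_
      calc _ ≤ ∑ ξ ∈ V', if ξ = u + (s - t) then (1 : ℝ) else 0 := by
            refine Finset.sum_le_sum fun ξ hξ => ?_
            split_ifs with hξu
            · exact (expect_nonneg_le_one V (fun _ _ => mul_nonneg (colInd_nonneg _ _ _ _ _)
                (colInd_nonneg _ _ _ _ _)) fun _ _ => mul_le_one₀ (colInd_le_one _ _ _ _ _)
                (colInd_nonneg _ _ _ _ _) (colInd_le_one _ _ _ _ _)).2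
            · obtain ⟨y', hy'⟩ := exists_mem_of_colAvg_pos hst
              exact (Finset.expect_eq_zero fun v _ =>
                colInd_mul_colInd_eq_zero hA U hy' hξu v).le
        _ ≤ 1 := by
            rw [Finset.sum_ite_eq']
            split_ifs <;> norm_num
    have := (abs_le.1 h).1
    linarith
  rcases grid_large_of_neg_corr X (V' ×ˢ V)
    (fun s ω => colInd A U (fun _ => u) ω.1 (ω.2 + s) - a ω.1)
    (fun s ω => colInd A U (fun ξ => ξ) ω.1 (ω.2 + s) - a ω.1) hp hm0 hpm
    (fun s t => 0 < a (u + (s - t))) hP hneg with h | h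
  · exact ⟨fun _ => u, hσ₁, hfin _ hσ₁ h⟩
  · exact ⟨fun ξ => ξ, hσ₂, hfin _ hσ₂ h⟩

end Structure

section DiffAvg
variable [AddCommGroup G]

theorem diffAvg_iterate_mono (W : Finset G) {f g : G → ℝ} (h : ∀ z, f z ≤ g z) (k : ℕ) (z : G) :
    (diffAvg W)^[k] f z ≤ (diffAvg W)^[k] g z := by
  induction k generalizing z with
  | zero => exact h z
  | succ k ih =>
    rw [Function.iterate_succ_apply', Function.iterate_succ_apply']
    exact Finset.expect_le_expect fun w _ => Finset.expect_le_expect fun w' _ => ih _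

theorem diffAvg_iterate_const_mul (W : Finset G) (c : ℝ) (f : G → ℝ) (k : ℕ) (z : G) :
    (diffAvg W)^[k] (fun x => c * f x) z = c * (diffAvg W)^[k] f z := by
  induction k generalizing z with
  | zero => rfl
  | succ k ih =>
    rw [Function.iterate_succ_apply', Function.iterate_succ_apply']
    simp only [diffAvg, ih, Finset.mul_expect]

theorem expect_diffAvg_iterate_le {W U : Finset G} (hW : W.Nonempty) {f : G → ℝ} {C : ℝ}
    (h : ∀ z, 𝔼 v ∈ U, f (z + v) ≤ C) (k : ℕ) (z : G) :
    𝔼 v ∈ U, (diffAvg W)^[k] f (z + v) ≤ C := by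
  induction k generalizing z with
  | zero => exact h z
  | succ k ih =>
    simp only [Function.iterate_succ_apply', diffAvg]
    rw [Finset.expect_comm]
    refine Finset.expect_le hW fun w _ => ?_
    rw [Finset.expect_comm]
    refine Finset.expect_le hW fun w' _ => ?_
    simpa only [add_right_comm z] using ih (z + (w - w'))

end DiffAvg

section Frequencies
variable [AddCommGroup G] [Fintype G]

theorem charMean_pow_mul_norm_le (W : Finset G) (γ : AddChar G ℂ) (v : G) (k : ℕ) {b : ℝ}
    (h : 1 / 2 ≤ ‖charMean W γ‖ → ‖1 - γ v‖ ≤ b) (hb : 2 * (1 / 4 : ℝ) ^ k ≤ b) :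
    ‖charMean W γ‖ ^ (2 * k) * ‖1 - γ v‖ ≤ b := by
  have hγ : ‖1 - γ v‖ ≤ 2 := by
    refine (norm_sub_le _ _).trans ?_
    rw [norm_one, AddChar.norm_apply]; norm_num
  have hm : ‖charMean W γ‖ ≤ 1 := by
    rw [charMean, Finset.expect_eq_sum_div_card, norm_div, Complex.norm_natCast]
    refine div_le_one_of_le₀ ((norm_sum_le _ _).trans ?_) (Nat.cast_nonneg _)
    simp [AddChar.norm_apply]
  by_cases hγW : 1 / 2 ≤ ‖charMean W γ‖
  · exact (mul_le_of_le_one_left (norm_nonneg _) (pow_le_one₀ (norm_nonneg _) hm)).trans (h hγW)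
  · have h2 : ‖charMean W γ‖ ^ 2 ≤ 1 / 4 := by nlinarith [norm_nonneg (charMean W γ)]
    have h3 : ‖charMean W γ‖ ^ (2 * k) ≤ (1 / 4) ^ k := by
      rw [pow_mul]
      exact pow_le_pow_left₀ (by positivity) h2 k
    have h4 : (0 : ℝ) ≤ (1 / 4) ^ k := by positivity
    calc _ ≤ (1 / 4) ^ k * 2 := mul_le_mul h3 hγ (norm_nonneg _) h4
      _ ≤ b := by linarith

theorem exists_frequencies {w : AddChar G ℂ → ℝ} (hw : ∀ γ, 0 ≤ w γ)
    {r₂ η₂ r₃ η₃ r₄ η₄ ε δ c : ℝ} (hr₂ : 0 ≤ r₂) (hr₃ : 0 ≤ r₃) (hη₃ : 0 ≤ η₃)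
    (hr₄ : 0 ≤ r₄) (hη₄ : 0 ≤ η₄)
    (hreg₂ : ((wbohr w (r₂ + η₂)).card : ℝ) ≤ 2 * (wbohr w r₂).card)
    (hreg₃ : ((wbohr w (r₃ + η₃)).card : ℝ) ≤ 2 * (wbohr w r₃).card)
    (hreg₄ : ((wbohr w (r₄ + η₄)).card : ℝ) ≤ (1 + ε) * (wbohr w r₄).card)
    {X : Finset G} (hX : X ⊆ wbohr w r₂) (hδ : 0 < δ) (hδX : δ * (wbohr w r₂).card ≤ X.card)
    {f : G → ℝ} (hf : WienerBound f (3 / 2)) (hf0 : ∀ z, 0 ≤ f z) (hc : 0 < c)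
    (hcf : 99 / 100 ≤ 𝔼 s ∈ X, 𝔼 t ∈ X, if c ≤ f (s - t) then (1 : ℝ) else 0)
    {k N n : ℕ} (hk : 0 < k) (hkc : 300 * (1 / 4 : ℝ) ^ k ≤ c) (hkr : 2 * k * r₃ ≤ η₂)
    (hN : 2 * Real.exp (-(N * (1 / (400 * k : ℝ)) ^ 2 / 4)) ≤ 1 / (400 * k) * (δ / 2) / 2)
    (hN0 : 0 < N) (hn : 40 * Real.log (2 / ((δ / 2) ^ N / 2)) ≤ n) (hnr : (n + 4) * r₄ ≤ η₃) :
    ∃ Λ : Finset (AddChar G ℂ), Λ.card ≤ n ∧ ∀ U : Finset G, U.Nonempty → U ⊆ wbohr w η₄ →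
      ∀ ρ : ℝ, 0 ≤ ρ → (∀ v ∈ U, ∀ l ∈ Λ, ‖1 - l v‖ ≤ ρ) → 150 * (4 * ε + n * ρ) ≤ c →
        ∃ z, 97 / 100 * c ≤ 𝔼 v ∈ U, f (z + v) := by
  have hkR : (1 : ℝ) ≤ k := by exact_mod_cast hk
  have hr₃η : r₃ ≤ η₂ := le_trans (by nlinarith) hkr
  have hB₂ : (0 : ℝ) < (wbohr w r₂).card := by exact_mod_cast (wbohr_nonempty w hr₂).card_pos
  have hB₃ : (0 : ℝ) < (wbohr w r₃).card := by exact_mod_cast (wbohr_nonempty w hr₃).card_pos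
  have hXne : X.Nonempty := by
    rw [← Finset.card_pos]
    have : (0 : ℝ) < X.card := lt_of_lt_of_le (by positivity) hδX
    exact_mod_cast this
  set T : G → ℝ := fun z => if c ≤ f z then 1 else 0 with hT
  have hT0 : ∀ z, 0 ≤ T z := fun z => by simp only [hT]; split_ifs <;> norm_num
  have hT1 : ∀ z, T z ≤ 1 := fun z => by simp only [hT]; split_ifs <;> norm_num
  have hτ : 0 < (δ / 2) ^ N / 2 := by positivity
  obtain ⟨W, hWsub, hWcard, hWper⟩ := almost_periodicity (Y := wbohr w (r₂ + η₂)) (W₀ := wbohr w r₃)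
    (δ := δ / 2) hXne (fun a ha v hv => add_mem_wbohr hw (hX ha) hv (by linarith)) (by positivity)
    (by nlinarith) T hT0 hT1 (ε := 1 / (400 * k)) (by positivity)
    (by rw [div_le_one (by positivity)]; linarith) hN0 hN
  have hWne : W.Nonempty := by
    rw [← Finset.card_pos]
    have : (0 : ℝ) < W.card := lt_of_lt_of_le (by positivity) hWcard
    exact_mod_cast this
  obtain ⟨Λ, hΛ, hspec⟩ := relative_chang hw hr₃ hη₃ hr₄ hη₄ hreg₃ hreg₄ hWne hWsub hτ hWcard hn hnr
  refine ⟨Λ, hΛ, fun U hU hUη ρ hρ hUΛ hερ => ?_⟩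
  set H : G → ℝ := fun t => 𝔼 a ∈ X, 𝔼 b ∈ X, T (a + t - b) with hH
  set F : G → ℝ := fun t => 𝔼 a ∈ X, 𝔼 b ∈ X, f (a + t - b) with hF
  have hHF : ∀ t, c * H t ≤ F t := by
    intro t
    simp only [hH, hF, Finset.mul_expect]
    refine Finset.expect_le_expect fun a _ => Finset.expect_le_expect fun b _ => ?_
    simp only [hT]
    split_ifs with h
    · linarith
    · simpa using hf0 _
  have hH0 : 99 / 100 ≤ H 0 := by simpa only [hH, hT, add_zero] using hcf
  have hHper := abs_diffAvg_iterate_sub_le hw hWne hWsub H (ε := 4 * (1 / (400 * k))) (η := η₂)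
    (fun t ht u hu u' hu' htu => hWper t
      (fun a ha => add_mem_wbohr hw (hX ha) ht le_rfl) u hu u' hu'
      (fun a ha => add_mem_wbohr hw (hX ha) htu le_rfl)) hr₃ k 0 (by linarith) 0
      (zero_mem_wbohr w le_rfl)
  have hk1 : (k : ℝ) * (4 * (1 / (400 * k))) = 1 / 100 := by field_simp; norm_num
  rw [hk1] at hHper
  have hKH : 98 / 100 ≤ (diffAvg W)^[k] H 0 := by linarith [(abs_le.1 hHper).1]
  have hKF : 98 / 100 * c ≤ (diffAvg W)^[k] F 0 := by
    have h := diffAvg_iterate_mono W hHF k 0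
    rw [diffAvg_iterate_const_mul] at h
    nlinarith
  have hFW : WienerBound F (3 / 2) := by
    refine WienerBound.expect hXne fun a _ => WienerBound.expect hXne fun b _ => ?_
    have := hf.translate (a - b)
    simpa only [sub_add_eq_add_sub] using this
  have hη : ∀ v ∈ U, ∀ γ : AddChar G ℂ, ‖charMean W γ‖ ^ (2 * k) * ‖1 - γ v‖ ≤ c / 150 := by
    intro v hv γ
    refine charMean_pow_mul_norm_le W γ v k (fun h => ?_) (by linarith)
    exact (hspec γ h v (hUη hv) ρ hρ (hUΛ v hv)).trans (by linarith)
  have hKFv : 97 / 100 * c ≤ 𝔼 v ∈ U, (diffAvg W)^[k] F (0 + v) := by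
    refine Finset.le_expect hU fun v hv => ?_
    rw [zero_add]
    linarith [(abs_le.1 (abs_diffAvg_iterate_zero_sub_le W hFW k v (hη v hv))).2]
  by_contra! hcon
  obtain ⟨z₀, -, hz₀⟩ := Finset.exists_max_image Finset.univ (fun z => 𝔼 v ∈ U, f (z + v))
    Finset.univ_nonempty
  refine absurd (hKFv.trans (expect_diffAvg_iterate_le hWne (fun z => ?_) k 0)) (hcon z₀).not_ge
  simp only [hF]
  rw [Finset.expect_comm]
  refine Finset.expect_le hXne fun a _ => ?_
  rw [Finset.expect_comm]
  refine Finset.expect_le hXne fun b _ => ?_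
  refine le_trans (le_of_eq ?_) (hz₀ (a + z - b) (Finset.mem_univ _))
  exact Finset.expect_congr rfl fun v _ => by congr 1; abel

end Frequencies

section Increment
variable [AddCommGroup G]

/-- The average autocorrelation of the column indicators `colInd A U σ ξ`. -/
def colCorr (A : Set (G × G)) (U : Finset G) (σ : G → G) (V' V : Finset G) (z : G) : ℝ :=
  𝔼 ξ ∈ V', 𝔼 v ∈ V, colInd A U σ ξ v * colInd A U σ ξ (v + z)

theorem colCorr_nonneg (A : Set (G × G)) (U : Finset G) (σ : G → G) (V' V : Finset G) (z : G) :
    0 ≤ colCorr A U σ V' V z :=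
  Finset.expect_nonneg fun _ _ => Finset.expect_nonneg fun _ _ =>
    mul_nonneg (colInd_nonneg _ _ _ _ _) (colInd_nonneg _ _ _ _ _)

theorem expect_colCorr_le {V' V W : Finset G} (A : Set (G × G)) (U : Finset G)
    (σ c : G → G) {ε : ℝ} (hε : 0 ≤ ε)
    (hσ : ∀ ξ ∈ V', 𝔼 v ∈ V, colInd A U σ ξ v ≤ colAvg A V ξ + ε)
    (hc : ∀ ξ y, 𝔼 v ∈ W, (if (ξ, y + v) ∈ A then (1 : ℝ) else 0) ≤ colAvg (shear A 0 c) W ξ)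
    (hV' : V'.Nonempty) (z : G) :
    𝔼 v ∈ W, colCorr A U σ V' V (z + v) ≤
      𝔼 ξ ∈ V', colAvg A V ξ * colAvg (shear A 0 c) W ξ + ε := by
  unfold colCorr
  rw [Finset.expect_comm]
  calc _ ≤ 𝔼 ξ ∈ V', (colAvg A V ξ * colAvg (shear A 0 c) W ξ + ε) := by
        refine Finset.expect_le_expect fun ξ hξ => ?_
        rw [Finset.expect_comm]
        calc _ ≤ 𝔼 y ∈ V, colInd A U σ ξ y * colAvg (shear A 0 c) W ξ := by
              refine Finset.expect_le_expect fun y _ => ?_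
              rw [← Finset.mul_expect]
              refine mul_le_mul_of_nonneg_left ?_ (colInd_nonneg _ _ _ _ _)
              refine le_trans (Finset.expect_le_expect fun v _ => ?_) (hc ξ (y + z + σ ξ))
              rw [colInd, show y + (z + v) + σ ξ = y + z + σ ξ + v by abel]
              split_ifs <;> simp_all
          _ ≤ _ := by
              rw [← Finset.expect_mul]
              have h0 := colAvg_nonneg (shear A 0 c) W ξ
              have h1 := colAvg_le_one (shear A 0 c) W ξ
              nlinarith [hσ ξ hξ]
    _ = _ := by rw [Finset.expect_add_distrib, Finset.expect_const hV']

variable [Fintype G]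

theorem abs_expect_sub_colCorr_le {w : AddChar G ℂ → ℝ} (hw : ∀ γ, 0 ≤ w γ) {r η ε : ℝ}
    (hr : 0 ≤ r) (hη : 0 ≤ η)
    (hreg : ((wbohr w (r + η)).card : ℝ) ≤ (1 + ε) * (wbohr w r).card)
    (A : Set (G × G)) (U : Finset G) (σ : G → G) {V' : Finset G} (hV' : V'.Nonempty) (s : G) {t : G}
    (ht : t ∈ wbohr w η) :
    |𝔼 ω ∈ V' ×ˢ wbohr w r, colInd A U σ ω.1 (ω.2 + s) * colInd A U σ ω.1 (ω.2 + t) -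
      colCorr A U σ V' (wbohr w r) (s - t)| ≤ ε := by
  rw [Finset.expect_product, colCorr, ← Finset.expect_sub_distrib]
  refine (Finset.abs_expect_le _ _).trans (Finset.expect_le hV' fun ξ _ => ?_)
  have h := abs_expect_shift_sub_le hw hr hη hreg ht
    (fun v => colInd A U σ ξ v * colInd A U σ ξ (v + (s - t)))
    (fun v => mul_nonneg (colInd_nonneg _ _ _ _ _) (colInd_nonneg _ _ _ _ _))
    (fun v => mul_le_one₀ (colInd_le_one _ _ _ _ _) (colInd_nonneg _ _ _ _ _)
      (colInd_le_one _ _ _ _ _))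
  refine le_of_eq_of_le ?_ h
  congr 2
  refine Finset.expect_congr rfl fun v _ => ?_
  rw [mul_comm]
  congr 2
  abel

theorem wienerBound_colCorr (A : Set (G × G)) (σ : G → G) {U V' V : Finset G}
    (hV' : V'.Nonempty) (hV : V.Nonempty) (hUV : (U.card : ℝ) ≤ 2 * V.card) :
    WienerBound (colCorr A U σ V' V) (3 / 2) := by
  have hVc : (0 : ℝ) < V.card := by exact_mod_cast hV.card_pos
  refine WienerBound.expect hV' fun ξ _ => ?_
  have h := ((wienerBound_correlation (fun v => if v ∈ V then colInd A U σ ξ v else 0)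
    (colInd A U σ ξ)).div hVc).mono (L' := 3 / 2) ?_
  · convert h using 2 with z
    rw [Finset.expect_eq_sum_div_card]
    congr 1
    simp
  · have h1 : ∑ v, (if v ∈ V then colInd A U σ ξ v else 0) ^ 2 ≤ V.card := by
      calc _ ≤ ∑ v, if v ∈ V then (1 : ℝ) else 0 := by
            refine Finset.sum_le_sum fun v _ => ?_
            split_ifs
            · exact pow_le_one₀ (colInd_nonneg _ _ _ _ _) (colInd_le_one _ _ _ _ _)
            · simp
        _ = _ := by simp
    have h2 : ∑ v, colInd A U σ ξ v ^ 2 ≤ U.card := by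
      calc _ ≤ ∑ v, if v + σ ξ ∈ U then (1 : ℝ) else 0 := by
            refine Finset.sum_le_sum fun v _ => ?_
            unfold colInd
            split_ifs <;> simp_all
        _ = ∑ v, if v ∈ U then (1 : ℝ) else 0 :=
            Fintype.sum_equiv (Equiv.addRight (σ ξ)) _ _ fun v => rfl
        _ = _ := by simp
    rw [div_le_iff₀ hVc]
    linarith

theorem exists_density_increment {A : Set (G × G)} (hA : IsSkewCornerFree A)
    {w : AddChar G ℂ → ℝ} (hw : ∀ γ, 0 ≤ w γ)
    {r η r₁ η₁ r₂ η₂ r₃ η₃ r₄ η₄ ε δ m : ℝ}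
    (hr : 0 ≤ r) (hη : 0 ≤ η) (hr₁ : 0 ≤ r₁) (hη₁ : 0 ≤ η₁) (hr₂ : 0 ≤ r₂)
    (hr₃ : 0 ≤ r₃) (hη₃ : 0 ≤ η₃) (hr₄ : 0 ≤ r₄) (hη₄ : 0 ≤ η₄) (hη₄₁ : η₄ ≤ η₁)
    (hreg : ((wbohr w (r + η)).card : ℝ) ≤ (1 + ε) * (wbohr w r).card)
    (hreg₁ : ((wbohr w (r₁ + η₁)).card : ℝ) ≤ (1 + ε) * (wbohr w r₁).card)
    (hreg₂ : ((wbohr w (r₂ + η₂)).card : ℝ) ≤ (1 + ε) * (wbohr w r₂).card)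
    (hreg₃ : ((wbohr w (r₃ + η₃)).card : ℝ) ≤ (1 + ε) * (wbohr w r₃).card)
    (hreg₄ : ((wbohr w (r₄ + η₄)).card : ℝ) ≤ (1 + ε) * (wbohr w r₄).card)
    (h₁ : r₁ + r₂ ≤ η) (h₂ : r₂ + r₂ ≤ η₁)
    (hm : 𝔼 ξ ∈ wbohr w r₁, colAvg A (wbohr w r) ξ ^ 2 = m) (hm0 : 0 < m)
    (hε : 2000 * ε ≤ m) (hcard : ((wbohr w r₁).card : ℝ)⁻¹ ≤ ε)
    {p : ℕ} (hp : Even p) (hp18 : 18 ≤ p) (hpm : 1 ≤ (9 / 5 : ℝ) ^ p * (m / 2))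
    (hδ : 0 < δ) (hδm : δ ≤ m ^ (4 * p))
    {k N n : ℕ} (hk : 0 < k) (hkm : 300 * (1 / 4 : ℝ) ^ k ≤ m) (hkr : 2 * k * r₃ ≤ η₂)
    (hN : 2 * Real.exp (-(N * (1 / (400 * k : ℝ)) ^ 2 / 4)) ≤ 1 / (400 * k) * (δ / 2) / 2)
    (hN0 : 0 < N) (hn : 40 * Real.log (2 / ((δ / 2) ^ N / 2)) ≤ n) (hnr : (n + 4) * r₄ ≤ η₃) :
    ∃ Λ : Finset (AddChar G ℂ), Λ.card ≤ n ∧ ∀ U : Finset G, U.Nonempty → U ⊆ wbohr w η₄ →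
      ∀ ρ : ℝ, 0 ≤ ρ → (∀ v ∈ U, ∀ l ∈ Λ, ‖1 - l v‖ ≤ ρ) → 150 * (4 * ε + n * ρ) ≤ m →
        ∃ (t : G) (c : G → G), 107 / 100 * m ≤ 𝔼 u ∈ U, colAvg (shear A t c) U u ^ 2 := by
  have hVne : (wbohr w r).Nonempty := wbohr_nonempty w hr
  have hV'ne : (wbohr w r₁).Nonempty := wbohr_nonempty w hr₁
  have hε0 : 0 ≤ ε := le_trans (by positivity) hcard
  have hm1 : m ≤ 1 := by
    rw [← hm]
    exact Finset.expect_le hV'ne fun ξ _ =>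
      pow_le_one₀ (colAvg_nonneg _ _ _) (colAvg_le_one _ _ _)
  have h2ε : ∀ r η : ℝ, ((wbohr w (r + η)).card : ℝ) ≤ (1 + ε) * (wbohr w r).card →
      ((wbohr w (r + η)).card : ℝ) ≤ 2 * (wbohr w r).card := fun r η h =>
    h.trans (mul_le_mul_of_nonneg_right (by linarith) (Nat.cast_nonneg _))
  obtain ⟨σ, hσ, X, hX, hXcard, hXcorr⟩ := exists_structured_pairs hA hw hr hη hr₁ hη₁ hr₂ hreg
    hreg₁ h₁ h₂ hm hm0 hε hcard hp hp18 hpm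
  set f := colCorr A (wbohr w (r + η)) σ (wbohr w r₁) (wbohr w r) with hf
  have hcf : 99 / 100 ≤ 𝔼 s ∈ X, 𝔼 t ∈ X, if 109 / 100 * m ≤ f (s - t) then (1 : ℝ) else 0 := by
    refine hXcorr.trans ?_
    refine Finset.expect_le_expect fun s hs => Finset.expect_le_expect fun t ht => ?_
    have h := abs_expect_sub_colCorr_le hw hr hη hreg A (wbohr w (r + η)) σ hV'ne s
      (wbohr_mono w (by linarith) (hX ht) : t ∈ wbohr w η)
    have := (abs_le.1 h).2
    split_ifs with ha hb
    · exact le_rfl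
    · exact absurd (by linarith) hb
    · exact zero_le_one
    · exact le_rfl
  obtain ⟨Λ, hΛ, hU⟩ := exists_frequencies hw hr₂ hr₃ hη₃ hr₄ hη₄ (h2ε _ _ hreg₂) (h2ε _ _ hreg₃)
    hreg₄ hX hδ ((mul_le_mul_of_nonneg_right hδm (Nat.cast_nonneg _)).trans hXcard)
    (wienerBound_colCorr A σ hV'ne hVne (h2ε _ _ hreg)) (colCorr_nonneg _ _ _ _ _)
    (c := 109 / 100 * m) (by positivity) hcf hk (by linarith) hkr hN hN0 hn hnr
  refine ⟨Λ, hΛ, fun U hUne hUη ρ hρ hUΛ hερ => ?_⟩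
  obtain ⟨z, hz⟩ := hU U hUne hUη ρ hρ hUΛ (by linarith)
  choose c hc using fun ξ : G => Finite.exists_max fun y : G =>
    𝔼 v ∈ U, if (ξ, y + v) ∈ A then (1 : ℝ) else 0
  set a := colAvg A (wbohr w r) with ha
  set b := colAvg (shear A 0 c) U with hb
  have hcb : ∀ ξ y, 𝔼 v ∈ U, (if (ξ, y + v) ∈ A then (1 : ℝ) else 0) ≤ b ξ := by
    intro ξ y
    refine (hc ξ y).trans (le_of_eq ?_)
    simp [hb, colAvg, shear]
  have hab := hz.trans (expect_colCorr_le A (wbohr w (r + η)) σ c hε0 (fun ξ hξ => ?_) hcb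
    hV'ne z)
  swap
  · have h := abs_expect_colInd_sub_le hw hr hη hreg A σ (ξ := ξ) (s := 0)
      (by rw [zero_add]; exact wbohr_mono w (by linarith) (hσ ξ hξ))
    simp only [add_zero] at h
    linarith [(abs_le.1 h).2]
  have hbb : 1081 / 1000 * m ≤ 𝔼 ξ ∈ wbohr w r₁, b ξ ^ 2 := by
    have h : 𝔼 ξ ∈ wbohr w r₁, (2 * (26 / 25) * (a ξ * b ξ)) ≤
        𝔼 ξ ∈ wbohr w r₁, ((26 / 25) ^ 2 * a ξ ^ 2 + b ξ ^ 2) :=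
      Finset.expect_le_expect fun ξ _ => by nlinarith [sq_nonneg (26 / 25 * a ξ - b ξ)]
    rw [Finset.expect_add_distrib, ← Finset.mul_expect, ← Finset.mul_expect, hm] at h
    linarith
  obtain ⟨t, -, ht⟩ := exists_shift_expect_ge hw hr₁ hη₁ hreg₁ hUne (fun v => v)
    (fun v hv => wbohr_mono w hη₄₁ (hUη hv)) (fun x => b x ^ 2) (fun x => sq_nonneg _)
    (fun x => pow_le_one₀ (colAvg_nonneg _ _ _) (colAvg_le_one _ _ _))
  refine ⟨t, fun x => c (t + x), ?_⟩
  refine le_trans (by linarith) (ht.trans (le_of_eq ?_))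
  refine Finset.expect_congr rfl fun u _ => ?_
  simp only [hb, colAvg, shear, Set.mem_ofPred_eq, zero_add]
  congr!

end Increment

section Constants

/-- The structured set found inside a Bohr set has relative density at least `2 ^ (-siftCost ℓ)`. -/
def siftCost (ℓ : ℕ) : ℕ := (ℓ + 1) * (4 * (2 * ℓ + 16))

/-- The number of random samples used for almost periodicity. -/
def sampleCount (ℓ : ℕ) : ℕ := 4 * (400 * (ℓ + 14)) ^ 2 * (12 + (ℓ + 14) + siftCost ℓ)

/-- The number of new frequencies in one density increment step. -/
def rankCost (ℓ : ℕ) : ℕ := 40 * (3 + sampleCount ℓ * (siftCost ℓ + 1))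

theorem sampleCount_spec (ℓ : ℕ) :
    2 * Real.exp (-(sampleCount ℓ * (1 / (400 * (ℓ + 14 : ℕ) : ℝ)) ^ 2 / 4)) ≤
      1 / (400 * (ℓ + 14 : ℕ)) * ((1 / 2 : ℝ) ^ siftCost ℓ / 2) / 2 := by
  have hk : (0 : ℝ) < (ℓ + 14 : ℕ) := by positivity
  have e : (sampleCount ℓ * (1 / (400 * (ℓ + 14 : ℕ) : ℝ)) ^ 2 / 4) =
      (12 + (ℓ + 14) + siftCost ℓ : ℕ) := by
    rw [sampleCount, Nat.cast_mul (4 * (400 * (ℓ + 14)) ^ 2)]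
    generalize (12 + (ℓ + 14) + siftCost ℓ : ℕ) = M
    generalize ℓ + 14 = k at *
    push_cast
    field_simp
  rw [e]
  have h1 : Real.exp (-((12 + (ℓ + 14) + siftCost ℓ : ℕ) : ℝ)) ≤
      (1 / 2) ^ (12 + (ℓ + 14) + siftCost ℓ) := by
    rw [← mul_one (((12 + (ℓ + 14) + siftCost ℓ : ℕ) : ℝ)), ← mul_neg, Real.exp_nat_mul]
    refine pow_le_pow_left₀ (Real.exp_pos _).le ?_ _
    rw [Real.exp_neg, one_div]
    exact inv_anti₀ two_pos (by linarith [Real.add_one_le_exp (1 : ℝ)])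
  have h2 : (1 / 2 : ℝ) ^ (ℓ + 14) ≤ 1 / (ℓ + 14 : ℕ) := by
    rw [one_div_pow]
    exact one_div_le_one_div_of_le hk (by exact_mod_cast Nat.lt_two_pow_self.le)
  have h3 : (0 : ℝ) < (1 / 2 : ℝ) ^ siftCost ℓ := by positivity
  rw [pow_add, pow_add] at h1
  have h4 := h1.trans (mul_le_mul_of_nonneg_right (mul_le_mul_of_nonneg_left h2
    (by positivity : (0 : ℝ) ≤ (1 / 2) ^ 12)) h3.le)
  have h5 : (0 : ℝ) < 1 / (ℓ + 14 : ℕ) * (1 / 2 : ℝ) ^ siftCost ℓ := by positivity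
  rw [show (1 : ℝ) / (400 * (ℓ + 14 : ℕ)) = 1 / 400 * (1 / (ℓ + 14 : ℕ)) by
    field_simp]
  generalize Real.exp _ = x at *
  generalize (1 / 2 : ℝ) ^ siftCost ℓ = b at *
  generalize 1 / ((ℓ + 14 : ℕ) : ℝ) = a at *
  linarith

theorem rankCost_spec (ℓ : ℕ) :
    40 * Real.log (2 / (((1 / 2 : ℝ) ^ siftCost ℓ / 2) ^ sampleCount ℓ / 2)) ≤ rankCost ℓ := by
  have e : (2 / (((1 / 2 : ℝ) ^ siftCost ℓ / 2) ^ sampleCount ℓ / 2)) =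
      2 ^ (sampleCount ℓ * (siftCost ℓ + 1) + 2) := by
    rw [show (1 / 2 : ℝ) ^ siftCost ℓ / 2 = (1 / 2) ^ (siftCost ℓ + 1) by ring, ← pow_mul,
      pow_add, mul_comm (sampleCount ℓ), one_div_pow]
    field_simp
  rw [e, Real.log_pow, rankCost]
  have h1 := Real.log_two_lt_d9
  have h2 : (0 : ℝ) ≤ (sampleCount ℓ * (siftCost ℓ + 1) : ℕ) := Nat.cast_nonneg _
  push_cast at h2 ⊢
  nlinarith

theorem siftCost_spec {ℓ : ℕ} {m : ℝ} (hm : (1 / 2) ^ (ℓ + 1) ≤ m) :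
    (1 / 2 : ℝ) ^ siftCost ℓ ≤ m ^ (4 * (2 * ℓ + 16)) := by
  rw [siftCost, pow_mul]
  exact pow_le_pow_left₀ (by positivity) hm _

theorem one_le_pow_mul_half {ℓ : ℕ} {m : ℝ} (hm : (1 / 2) ^ (ℓ + 1) ≤ m) :
    1 ≤ (9 / 5 : ℝ) ^ (2 * ℓ + 16) * (m / 2) := by
  have h1 : (2 : ℝ) ^ (ℓ + 8) ≤ (9 / 5) ^ (2 * ℓ + 16) := by
    rw [show 2 * ℓ + 16 = 2 * (ℓ + 8) by ring, pow_mul]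
    exact pow_le_pow_left₀ (by norm_num) (by norm_num) _
  calc (1 : ℝ) ≤ 2 ^ 6 * (2 * (1 / 2)) ^ (ℓ + 2) := by norm_num
    _ = 2 ^ (ℓ + 8) * ((1 / 2) ^ (ℓ + 1) / 2) := by rw [mul_pow]; ring
    _ ≤ _ := by gcongr

theorem mul_quarter_pow_le {ℓ : ℕ} {m : ℝ} (hm : (1 / 2) ^ (ℓ + 1) ≤ m) :
    300 * (1 / 4 : ℝ) ^ (ℓ + 14) ≤ m := by
  refine le_trans ?_ hm
  have h1 : (1 / 4 : ℝ) ^ ℓ ≤ (1 / 2) ^ ℓ := pow_le_pow_left₀ (by norm_num) (by norm_num) _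
  have h2 := mul_le_mul h1 (by norm_num : (1 / 4 : ℝ) ^ 14 ≤ 1 / 600) (by positivity)
    (by positivity)
  rw [pow_add (1 / 4 : ℝ), pow_succ (1 / 2 : ℝ)]
  linarith

end Constants

section Step
variable [AddCommGroup G] [Fintype G]

/-- Some skew-corner-free set has mean square column density at least `θ` on a regular Bohr set
with at most `d` frequencies and weights at most `H`. -/
def HasDensity (G : Type*) [AddCommGroup G] [Fintype G] (E D d : ℕ) (H θ : ℝ) : Prop :=
  ∃ (A : Set (G × G)) (w : AddChar G ℂ → ℝ) (S : Finset (AddChar G ℂ)) (r : ℝ),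
    IsSkewCornerFree A ∧ (∀ γ, 0 ≤ w γ) ∧ (∀ γ, w γ ≤ H) ∧ (∀ γ ∉ S, w γ = 0) ∧ S.card ≤ d ∧
    1 / 2 ≤ r ∧ r ≤ 1 ∧
    ((wbohr w (r + 1 / (14 * D * E) * 1)).card : ℝ) ≤ (1 + 1 / E) * (wbohr w r).card ∧
    θ ≤ 𝔼 u ∈ wbohr w r, colAvg A (wbohr w r) u ^ 2

theorem inv_card_wbohr_le {w : AddChar G ℂ → ℝ} (hw : ∀ γ, 0 ≤ w γ) {H : ℝ} (hwH : ∀ γ, w γ ≤ H)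
    {S : Finset (AddChar G ℂ)} (hS : ∀ γ ∉ S, w γ = 0) {D E J : ℕ} (hE : 1 ≤ E) (hSD : S.card ≤ D)
    {r : ℝ} (hr : 0 < r) (hJ : 2 * H ≤ J * r)
    (hG : E * ((4 * J + 1) ^ 2) ^ D ≤ Fintype.card G) :
    ((wbohr w r).card : ℝ)⁻¹ ≤ 1 / E := by
  have h := card_le_mul_card_wbohr hw hS J hr Finset.univ fun x _ γ => by
    have hγ : ‖1 - γ x‖ ≤ 2 := by
      refine (norm_sub_le _ _).trans ?_
      rw [norm_one, AddChar.norm_apply]; norm_num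
    nlinarith [mul_le_mul (hwH γ) hγ (norm_nonneg _) ((hw γ).trans (hwH γ))]
  rw [Finset.card_univ] at h
  have h2 : ((4 * J + 1) ^ 2) ^ S.card ≤ ((4 * J + 1) ^ 2) ^ D :=
    Nat.pow_le_pow_right (by positivity) hSD
  have h3 : E ≤ (wbohr w r).card := by
    have h4 := hG.trans (h.trans (Nat.mul_le_mul_right _ h2))
    rw [mul_comm] at h4
    exact Nat.le_of_mul_le_mul_left h4 (by positivity)
  rw [inv_eq_one_div]
  exact one_div_le_one_div_of_le (by exact_mod_cast hE) (by exact_mod_cast h3)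

/-- The factor by which the weights grow in a density increment step. -/
def weightCost (ℓ D : ℕ) : ℕ :=
  64 * (ℓ + 14) * (rankCost ℓ + 4) * (14 * D * 2 ^ (ℓ + 14)) ^ 5

theorem IsSkewCornerFree.exists_zoom {A : Set (G × G)} (hA : IsSkewCornerFree A)
    {w : AddChar G ℂ → ℝ} (hw : ∀ γ, 0 ≤ w γ) {r η r₁ ε : ℝ} (hr : 0 ≤ r) (hη : 0 ≤ η)
    (hreg : ((wbohr w (r + η)).card : ℝ) ≤ (1 + ε) * (wbohr w r).card)
    (hr₁ : 0 ≤ r₁) (hr₁η : r₁ ≤ η) :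
    ∃ A' : Set (G × G), IsSkewCornerFree A' ∧
      𝔼 v ∈ wbohr w r, colAvg A (wbohr w r) v ^ 2 - ε ≤
        𝔼 ξ ∈ wbohr w r₁, colAvg A' (wbohr w r) ξ ^ 2 := by
  obtain ⟨u, -, hu⟩ := exists_shift_expect_ge hw hr hη hreg (wbohr_nonempty w hr₁) (fun v => v)
    (fun v hv => wbohr_mono w hr₁η hv) (fun x => colAvg A (wbohr w r) x ^ 2)
    (fun x => sq_nonneg _) (fun x => pow_le_one₀ (colAvg_nonneg _ _ _) (colAvg_le_one _ _ _))
  refine ⟨SkewPaper.shear A u fun _ => 0, hA.shear _ _, hu.trans (le_of_eq ?_)⟩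
  refine Finset.expect_congr rfl fun v _ => ?_
  simp only [colAvg, SkewPaper.shear, Set.mem_ofPred_eq, zero_add]

theorem exists_regular_radii {w : AddChar G ℂ → ℝ} (hw : ∀ γ, 0 ≤ w γ)
    {S : Finset (AddChar G ℂ)} (hS : ∀ γ ∉ S, w γ = 0) {D E : ℕ} (hD : 1 ≤ D) (hE : 1 ≤ E)
    (hSD : S.card ≤ D) {k n : ℕ} (hk : 1 ≤ k) {κ : ℝ} (hκ : κ = 1 / (14 * D * E)) :
    ∃ r₁ η₁ r₂ η₂ r₃ η₃ r₄ η₄ : ℝ, κ / 8 ≤ r₁ ∧ 0 < η₁ ∧ 0 ≤ r₂ ∧ 0 < η₂ ∧ 0 ≤ r₃ ∧ 0 < η₃ ∧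
      0 ≤ r₄ ∧ 0 < η₄ ∧ η₄ ≤ η₁ ∧
      ((wbohr w (r₁ + η₁)).card : ℝ) ≤ (1 + 1 / E) * (wbohr w r₁).card ∧
      ((wbohr w (r₂ + η₂)).card : ℝ) ≤ (1 + 1 / E) * (wbohr w r₂).card ∧
      ((wbohr w (r₃ + η₃)).card : ℝ) ≤ (1 + 1 / E) * (wbohr w r₃).card ∧
      ((wbohr w (r₄ + η₄)).card : ℝ) ≤ (1 + 1 / E) * (wbohr w r₄).card ∧
      r₁ + r₂ ≤ κ ∧ r₂ + r₂ ≤ η₁ ∧ 2 * k * r₃ ≤ η₂ ∧ (n + 4) * r₄ ≤ η₃ ∧ E * n * η₄ ≤ 1 ∧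
      2 / η₄ = 64 * k * (n + 4) * (14 * D * E) ^ 5 := by
  have hD0 : (1 : ℝ) ≤ D := by exact_mod_cast hD
  have hE0 : (1 : ℝ) ≤ E := by exact_mod_cast hE
  have hk0 : (1 : ℝ) ≤ k := by exact_mod_cast hk
  have hn0 : (0 : ℝ) ≤ n := Nat.cast_nonneg n
  have hκ0 : 0 < κ := by rw [hκ]; positivity
  have hκE : κ * E ≤ 1 := by
    rw [hκ, one_div_mul_eq_div, div_le_one (by positivity)]
    nlinarith
  have hκ1 : κ ≤ 1 := le_trans (by nlinarith) hκE
  have hrad : ∀ {ρ : ℝ}, 0 < ρ → ∃ r', ρ / 2 ≤ r' ∧ r' ≤ ρ ∧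
      ((wbohr w (r' + κ * ρ)).card : ℝ) ≤ (1 + 1 / E) * (wbohr w r').card := by
    intro ρ hρ
    rw [hκ]
    exact exists_regular_radius hw hS hD hE hSD hρ
  have hmono : ∀ {η c : ℝ}, 0 < η → 1 ≤ c → 0 < κ * (η / c) ∧ κ * (η / c) ≤ η := fun hη hc =>
    ⟨by positivity, (mul_le_of_le_one_left (by positivity) hκ1).trans (div_le_self hη.le hc)⟩
  obtain ⟨r₁, hr₁, hr₁', hreg₁⟩ := hrad (ρ := κ / 4) (by positivity)
  obtain ⟨hη₁0, hη₁⟩ := hmono (c := 4) hκ0 (by norm_num)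
  have e₁ : κ * (κ / 4) = κ ^ 2 / 4 := by ring
  generalize κ * (κ / 4) = η₁ at *
  obtain ⟨r₂, hr₂, hr₂', hreg₂⟩ := hrad (ρ := η₁ / 4) (by positivity)
  obtain ⟨hη₂0, hη₂⟩ := hmono (c := 4) hη₁0 (by norm_num)
  have e₂ : κ * (η₁ / 4) = κ ^ 3 / 16 := by rw [e₁]; ring
  generalize hη₂d : κ * (η₁ / 4) = η₂ at *
  obtain ⟨r₃, hr₃, hr₃', hreg₃⟩ := hrad (ρ := η₂ / (2 * k)) (by positivity)
  obtain ⟨hη₃0, hη₃⟩ := hmono (c := 2 * k) hη₂0 (by linarith)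
  have e₃ : κ * (η₂ / (2 * k)) = κ ^ 4 / (32 * k) := by rw [e₂]; field_simp; norm_num
  generalize κ * (η₂ / (2 * k)) = η₃ at *
  obtain ⟨r₄, hr₄, hr₄', hreg₄⟩ := hrad (ρ := η₃ / (n + 4)) (by positivity)
  obtain ⟨hη₄0, hη₄⟩ := hmono (c := n + 4) hη₃0 (by linarith)
  have e₄ : κ * (η₃ / (n + 4)) = κ ^ 5 / (32 * k * (n + 4)) := by rw [e₃]; field_simp
  have hηn : E * n * (κ * (η₃ / (n + 4))) ≤ 1 := by
    calc E * n * (κ * (η₃ / (n + 4))) = κ * E * (η₃ * (n / (n + 4))) := by ring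
      _ ≤ 1 * (1 * 1) := by
          have h1 : η₃ ≤ 1 := by
            refine hη₃.trans (hη₂.trans (hη₁.trans hκ1))
          have h2 : (n : ℝ) / (n + 4) ≤ 1 := div_le_one_of_le₀ (by linarith) (by positivity)
          gcongr
      _ = 1 := by norm_num
  generalize κ * (η₃ / (n + 4)) = η₄ at *
  refine ⟨r₁, η₁, r₂, η₂, r₃, η₃, r₄, η₄, by linarith, hη₁0, le_trans (by positivity) hr₂, hη₂0,
    le_trans (by positivity) hr₃, hη₃0, le_trans (by positivity) hr₄, hη₄0,
    hη₄.trans (hη₃.trans hη₂), hreg₁, hreg₂, hreg₃, hreg₄, by linarith, by linarith, ?_, ?_, hηn,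
    ?_⟩
  · rwa [le_div_iff₀ (by positivity), mul_comm] at hr₃'
  · rwa [le_div_iff₀ (by positivity), mul_comm] at hr₄'
  · rw [e₄, hκ]
    field_simp
    norm_num

theorem exists_increment_frequencies {A : Set (G × G)} (hA : IsSkewCornerFree A)
    {w : AddChar G ℂ → ℝ} (hw : ∀ γ, 0 ≤ w γ) {H : ℝ} (hwH : ∀ γ, w γ ≤ H)
    {S : Finset (AddChar G ℂ)}
    (hS : ∀ γ ∉ S, w γ = 0) {ℓ D E J : ℕ} (hℓ : 1 ≤ ℓ) (hD : 1 ≤ D) (hSD : S.card ≤ D)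
    (hE : E = 2 ^ (ℓ + 14)) (hJ : 16 * H * (14 * D * E) ≤ J)
    (hG : E * ((4 * J + 1) ^ 2) ^ D ≤ Fintype.card G) {r : ℝ} (hr : 0 ≤ r)
    (hreg : ((wbohr w (r + 1 / (14 * D * E) * 1)).card : ℝ) ≤ (1 + 1 / E) * (wbohr w r).card)
    {θ : ℝ} (hθ : (1 / 2) ^ ℓ ≤ θ) (hθA : θ ≤ 𝔼 u ∈ wbohr w r, colAvg A (wbohr w r) u ^ 2) :
    ∃ (η : ℝ) (Λ : Finset (AddChar G ℂ)), 0 < η ∧ E * rankCost ℓ * η ≤ 1 ∧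
      2 / η = 64 * (ℓ + 14 : ℕ) * (rankCost ℓ + 4) * (14 * D * E) ^ 5 ∧ Λ.card ≤ rankCost ℓ ∧
      ∀ U : Finset G, U.Nonempty → U ⊆ wbohr w η →
        (∀ v ∈ U, ∀ l ∈ Λ, E * rankCost ℓ * ‖1 - l v‖ ≤ 1) →
        ∃ A' : Set (G × G), IsSkewCornerFree A' ∧
          21 / 20 * θ ≤ 𝔼 u ∈ U, colAvg A' U u ^ 2 := by
  have hE1 : 1 ≤ E := hE ▸ Nat.one_le_two_pow
  have hE0 : (1 : ℝ) ≤ E := by exact_mod_cast hE1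
  have hD0 : (1 : ℝ) ≤ D := by exact_mod_cast hD
  obtain ⟨κ, hκ⟩ : ∃ κ : ℝ, κ = 1 / (14 * D * E) := ⟨_, rfl⟩
  have hκ0 : 0 < κ := by rw [hκ]; positivity
  rw [← hκ, mul_one] at hreg
  obtain ⟨r₁, η₁, r₂, η₂, r₃, η₃, r₄, η₄, hr₁, hη₁, hr₂, -, hr₃, hη₃, hr₄, hη₄, hη₄₁, hreg₁,
    hreg₂, hreg₃, hreg₄, h₁, h₂, hkr, hnr, hηn, hη⟩ := exists_regular_radii hw hS hD hE1 hSD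
    (k := ℓ + 14) (n := rankCost ℓ) (by omega) hκ
  have hr₁0 : 0 < r₁ := lt_of_lt_of_le (by positivity) hr₁
  have hcard : ((wbohr w r₁).card : ℝ)⁻¹ ≤ 1 / E := by
    refine inv_card_wbohr_le hw hwH hS hE1 hSD hr₁0 ?_ hG
    have h1 : 16 * H ≤ J * κ := by
      rw [hκ, mul_one_div, le_div_iff₀ (by positivity)]
      exact hJ
    have h2 := mul_le_mul_of_nonneg_left hr₁ (Nat.cast_nonneg J : (0 : ℝ) ≤ J)
    linarith
  obtain ⟨A₁, hA₁, hm⟩ := hA.exists_zoom hw hr hκ0.le hreg hr₁0.le (by linarith)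
  obtain ⟨m, hmd⟩ : ∃ m, 𝔼 ξ ∈ wbohr w r₁, colAvg A₁ (wbohr w r) ξ ^ 2 = m := ⟨_, rfl⟩
  have hEθ : 16384 * (1 / E : ℝ) ≤ θ := by
    refine le_trans (le_of_eq ?_) hθ
    rw [hE]
    push_cast
    rw [one_div_pow, pow_add]
    field_simp
    norm_num
  have hE2 : (0 : ℝ) < 1 / E := by positivity
  rw [hmd] at hm
  have hmθ : θ - 1 / E ≤ m := by linarith
  have hmℓ : (1 / 2 : ℝ) ^ (ℓ + 1) ≤ m := by rw [pow_succ]; linarith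
  have hkm := mul_quarter_pow_le hmℓ
  have hδ : (0 : ℝ) < (1 / 2) ^ siftCost ℓ := by positivity
  have hδm := siftCost_spec hmℓ
  have hN := sampleCount_spec ℓ
  have hN0 : 0 < sampleCount ℓ := by rw [sampleCount]; positivity
  have hn := rankCost_spec ℓ
  have hn0 : 0 < rankCost ℓ := by rw [rankCost]; positivity
  have hpm := one_le_pow_mul_half hmℓ
  have hp : Even (2 * ℓ + 16) := ⟨ℓ + 8, by ring⟩
  have hp18 : 18 ≤ 2 * ℓ + 16 := by omega
  have hk : 0 < ℓ + 14 := by omega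
  generalize rankCost ℓ = n at *
  generalize sampleCount ℓ = N at *
  generalize (1 / 2 : ℝ) ^ siftCost ℓ = δ at *
  generalize 2 * ℓ + 16 = p at *
  generalize ℓ + 14 = k at *
  have hm0 : 0 < m := by linarith
  have hmε : 2000 * (1 / E : ℝ) ≤ m := by linarith
  obtain ⟨Λ, hΛ, hU⟩ := exists_density_increment hA₁ hw hr hκ0.le hr₁0.le hη₁.le hr₂ hr₃
    hη₃.le hr₄ hη₄.le hη₄₁ hreg hreg₁ hreg₂ hreg₃ hreg₄ h₁ h₂ hmd hm0 hmε hcard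
    hp hp18 hpm hδ hδm hk hkm hkr hN hN0 hn hnr
  refine ⟨η₄, Λ, hη₄, hηn, hη, hΛ, fun U hUne hUη hUΛ => ?_⟩
  have hn0' : (0 : ℝ) < n := by exact_mod_cast hn0
  obtain ⟨t, c, htc⟩ := hU U hUne hUη (1 / (E * n)) (by positivity)
    (fun v hv l hl => by
      rw [le_div_iff₀ (by positivity), mul_comm]
      exact hUΛ v hv l hl)
    (by
      rw [show (n : ℝ) * (1 / (E * n)) = 1 / E by field_simp]
      linarith)
  exact ⟨_, hA₁.shear t c, by linarith⟩

theorem HasDensity.step {ℓ D d J : ℕ} {H θ : ℝ} (hℓ : 1 ≤ ℓ) (hD : d + rankCost ℓ ≤ D)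
    (hH : 1 ≤ H) (hθ : (1 / 2) ^ ℓ ≤ θ) (hJ : 16 * H * (14 * D * (2 ^ (ℓ + 14) : ℕ)) ≤ J)
    (hG : 2 ^ (ℓ + 14) * ((4 * J + 1) ^ 2) ^ D ≤ Fintype.card G)
    (h : HasDensity G (2 ^ (ℓ + 14)) D d H θ) :
    HasDensity G (2 ^ (ℓ + 14)) D (d + rankCost ℓ) (weightCost ℓ D * H) (21 / 20 * θ) := by
  obtain ⟨A, w, S, r, hA, hw, hwH, hS, hSd, hr, hr1, hreg, hθA⟩ := h
  have hn1 : 1 ≤ rankCost ℓ := by rw [rankCost]; omega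
  obtain ⟨η, Λ, hη, hηn, hη2, hΛ, hU⟩ := exists_increment_frequencies hA hw hwH hS hℓ (by omega)
    (hSd.trans (by omega)) rfl hJ hG (by linarith) hreg hθ hθA
  rw [show (weightCost ℓ D : ℝ) = 2 / η by rw [hη2, weightCost]; push_cast; ring]
  have hE1 : 1 ≤ 2 ^ (ℓ + 14) := Nat.one_le_two_pow
  have hE0 : (1 : ℝ) ≤ (2 ^ (ℓ + 14) : ℕ) := by exact_mod_cast hE1
  generalize 2 ^ (ℓ + 14) = E at *
  generalize rankCost ℓ = n at *
  have hEn : (0 : ℝ) ≤ E * n := by positivity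
  have hηn' : E * n ≤ 1 / η := by rwa [le_div_iff₀ hη]
  set w' : AddChar G ℂ → ℝ := fun γ => w γ / η + if γ ∈ Λ then (E * n : ℝ) else 0 with hw'
  have hw'w : ∀ γ, w γ / η ≤ w' γ := fun γ => by
    simp only [hw']; split_ifs <;> linarith
  have hw'0 : ∀ γ, 0 ≤ w' γ := fun γ => (div_nonneg (hw γ) hη.le).trans (hw'w γ)
  have hS' : ∀ γ ∉ S ∪ Λ, w' γ = 0 := fun γ hγ => by
    rw [Finset.mem_union, not_or] at hγ
    simp [hw', hS γ hγ.1, hγ.2]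
  have hcard : (S ∪ Λ).card ≤ d + n := (Finset.card_union_le _ _).trans (add_le_add hSd hΛ)
  obtain ⟨r', hr', hr1', hreg'⟩ := exists_regular_radius hw'0 hS' (by omega : 1 ≤ D) hE1
    (hcard.trans hD) one_pos
  obtain ⟨A', hA', hθ'⟩ := hU (wbohr w' r') (wbohr_nonempty w' (by linarith))
    (fun v hv => by
      rw [mem_wbohr] at hv ⊢
      intro γ
      have h1 := (mul_le_mul_of_nonneg_right (hw'w γ) (norm_nonneg (1 - γ v))).trans
        ((hv γ).trans hr1')
      rwa [div_mul_eq_mul_div, div_le_one hη] at h1)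
    (fun v hv l hl => by
      rw [mem_wbohr] at hv
      have h1 : E * n ≤ w' l := by
        simp only [hw', hl, if_true]
        linarith [div_nonneg (hw l) hη.le]
      exact (mul_le_mul_of_nonneg_right h1 (norm_nonneg _)).trans ((hv l).trans hr1'))
  refine ⟨A', w', S ∪ Λ, r', hA', hw'0, fun γ => ?_, hS', hcard, hr', hr1', hreg', hθ'⟩
  have h1 : w γ / η ≤ H / η := div_le_div_of_nonneg_right (hwH γ) hη.le
  have h2 : 1 / η ≤ H / η := div_le_div_of_nonneg_right hH hη.le
  have h3 : 2 / η * H = H / η + H / η := by ring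
  rw [h3]
  simp only [hw']
  split_ifs <;> linarith

end Step

section Iteration
variable [AddCommGroup G] [Fintype G]

theorem HasDensity.le_one {E D d : ℕ} {H θ : ℝ} (h : HasDensity G E D d H θ) : θ ≤ 1 := by
  obtain ⟨A, w, S, r, -, -, -, -, -, hr, -, -, hθ⟩ := h
  exact hθ.trans (Finset.expect_le (wbohr_nonempty w (by linarith)) fun x _ =>
    pow_le_one₀ (colAvg_nonneg _ _ _) (colAvg_le_one _ _ _))

theorem IsSkewCornerFree.hasDensity {A : Set (G × G)} (hA : IsSkewCornerFree A) (E D : ℕ) :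
    HasDensity G E D 0 1 ((𝔼 x, colAvg A Finset.univ x) ^ 2) := by
  have hB : ∀ r : ℝ, 0 ≤ r → wbohr (0 : AddChar G ℂ → ℝ) r = Finset.univ := fun r hr => by
    ext x; simp [mem_wbohr, hr]
  refine ⟨A, 0, ∅, 1, hA, fun _ => le_rfl, fun _ => zero_le_one, fun _ _ => rfl, by simp,
    by norm_num, le_rfl, ?_, ?_⟩
  · rw [hB _ (by positivity), hB _ zero_le_one]
    exact le_mul_of_one_le_left (Nat.cast_nonneg _) (le_add_of_nonneg_right (by positivity))
  · rw [hB _ zero_le_one, Finset.expect_eq_sum_div_card, Finset.expect_eq_sum_div_card]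
    exact sum_div_card_sq_le_sum_sq_div_card

theorem HasDensity.iterate {ℓ D J T : ℕ} {θ : ℝ} (hℓ : 1 ≤ ℓ) (hD : T * rankCost ℓ ≤ D)
    (hθ : (1 / 2) ^ ℓ ≤ θ) (hJ : 16 * weightCost ℓ D ^ T * (14 * D * 2 ^ (ℓ + 14)) ≤ J)
    (hG : 2 ^ (ℓ + 14) * ((4 * J + 1) ^ 2) ^ D ≤ Fintype.card G)
    (h : HasDensity G (2 ^ (ℓ + 14)) D 0 1 θ) {i : ℕ} (hi : i ≤ T) :
    HasDensity G (2 ^ (ℓ + 14)) D (i * rankCost ℓ) ((weightCost ℓ D ^ i : ℕ) : ℝ)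
      ((21 / 20) ^ i * θ) := by
  induction i with
  | zero => simpa using h
  | succ i ih =>
    have hn : 1 ≤ rankCost ℓ := by rw [rankCost]; omega
    have hid : (i + 1) * rankCost ℓ ≤ D := (Nat.mul_le_mul_right _ hi).trans hD
    have hD1 : 0 < D := by nlinarith
    have hW : 1 ≤ weightCost ℓ D := Nat.succ_le_of_lt (by rw [weightCost]; positivity)
    have hθ' : θ ≤ (21 / 20) ^ i * θ :=
      le_mul_of_one_le_left (le_trans (by positivity) hθ) (one_le_pow₀ (by norm_num))
    have hWi : weightCost ℓ D ^ i ≤ weightCost ℓ D ^ T := Nat.pow_le_pow_right hW (by omega)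
    have := HasDensity.step (d := i * rankCost ℓ) hℓ (by linarith)
      (by exact_mod_cast Nat.one_le_pow _ _ hW) (hθ.trans hθ')
      (by exact_mod_cast (by gcongr : 16 * weightCost ℓ D ^ i * (14 * D * 2 ^ (ℓ + 14)) ≤
        16 * weightCost ℓ D ^ T * (14 * D * 2 ^ (ℓ + 14))).trans hJ) hG (ih (by omega))
    convert this using 1
    · ring
    · push_cast; ring
    · ring

theorem one_lt_pow_mul_half_pow {ℓ : ℕ} (hℓ : 1 ≤ ℓ) :
    1 < (21 / 20 : ℝ) ^ (15 * ℓ) * (1 / 2) ^ ℓ := by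
  rw [pow_mul, ← mul_pow]
  exact one_lt_pow₀ (by norm_num) (by omega)

/-- A bound for the rank of all the Bohr sets in the density increment argument. -/
def maxRank (ℓ : ℕ) : ℕ := 15 * ℓ * rankCost ℓ

/-- A bound for the inverse radius of all the Bohr sets in the density increment argument. -/
def maxWeight (ℓ : ℕ) : ℕ :=
  16 * weightCost ℓ (maxRank ℓ) ^ (15 * ℓ) * (14 * maxRank ℓ * 2 ^ (ℓ + 14))

theorem IsSkewCornerFree.card_lt {A : Set (G × G)} (hA : IsSkewCornerFree A) {ℓ : ℕ} (hℓ : 1 ≤ ℓ)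
    (hα : (1 / 2) ^ ℓ ≤ (𝔼 x, colAvg A Finset.univ x) ^ 2) :
    Fintype.card G < 2 ^ (ℓ + 14) * ((4 * maxWeight ℓ + 1) ^ 2) ^ maxRank ℓ := by
  by_contra! hG
  have h := ((hA.hasDensity _ _).iterate (T := 15 * ℓ) hℓ le_rfl hα le_rfl hG le_rfl).le_one
  have h1 := one_lt_pow_mul_half_pow hℓ
  have h2 := mul_le_mul_of_nonneg_left hα (by positivity : (0 : ℝ) ≤ (21 / 20) ^ (15 * ℓ))
  linarith

theorem rankCost_le {ℓ : ℕ} (hℓ : 1 ≤ ℓ) : rankCost ℓ ≤ 2 ^ 48 * ℓ ^ 6 := by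
  have h2 : ℓ ≤ ℓ ^ 2 := Nat.le_self_pow two_ne_zero _
  have h6 : 1 ≤ ℓ ^ 6 := Nat.one_le_pow _ _ hℓ
  have hs : siftCost ℓ ≤ 144 * ℓ ^ 2 := by
    calc siftCost ℓ ≤ (2 * ℓ) * (4 * (18 * ℓ)) := by
          rw [siftCost]; gcongr <;> omega
      _ = _ := by ring
  have hN : sampleCount ℓ ≤ 24624000000 * ℓ ^ 4 := by
    calc sampleCount ℓ ≤ 4 * (400 * (15 * ℓ)) ^ 2 * (171 * ℓ ^ 2) := by
          rw [sampleCount]; gcongr <;> omega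
      _ = _ := by ring
  calc rankCost ℓ ≤ 40 * (3 + 24624000000 * ℓ ^ 4 * (145 * ℓ ^ 2)) := by
        rw [rankCost]; gcongr; omega
    _ = 120 + 142819200000000 * ℓ ^ 6 := by ring
    _ ≤ 2 ^ 48 * ℓ ^ 6 := by omega

theorem maxRank_le {ℓ : ℕ} (hℓ : 1 ≤ ℓ) : maxRank ℓ ≤ 2 ^ 52 * ℓ ^ 7 := by
  calc maxRank ℓ ≤ 16 * ℓ * (2 ^ 48 * ℓ ^ 6) := by
        rw [maxRank]; gcongr; · norm_num
        exact rankCost_le hℓ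
    _ = _ := by ring

theorem mul_pow_le_two_pow {a b ℓ : ℕ} (hℓ : 1 ≤ ℓ) : 2 ^ a * ℓ ^ b ≤ 2 ^ ((a + b) * ℓ) := by
  calc 2 ^ a * ℓ ^ b ≤ 2 ^ (a * ℓ) * (2 ^ ℓ) ^ b := by
        gcongr
        · norm_num
        · exact Nat.le_mul_of_pos_right _ hℓ
        · exact Nat.lt_two_pow_self.le
    _ = _ := by rw [← pow_mul, ← pow_add]; ring

theorem maxWeight_le {ℓ : ℕ} (hℓ : 1 ≤ ℓ) : maxWeight ℓ ≤ 2 ^ (7072 * ℓ ^ 2) := by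
  have hE : 14 * maxRank ℓ * 2 ^ (ℓ + 14) ≤ 2 ^ (78 * ℓ) := by
    calc 14 * maxRank ℓ * 2 ^ (ℓ + 14) ≤ 2 ^ 4 * 2 ^ ((52 + 7) * ℓ) * 2 ^ (ℓ + 14) := by
          gcongr
          · norm_num
          · exact (maxRank_le hℓ).trans (mul_pow_le_two_pow hℓ)
      _ = 2 ^ (60 * ℓ + 18) := by rw [← pow_add, ← pow_add]; ring
      _ ≤ _ := Nat.pow_le_pow_right two_pos (by omega)
  have hW : weightCost ℓ (maxRank ℓ) ≤ 2 ^ (466 * ℓ) := by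
    have h6 : 1 ≤ ℓ ^ 6 := Nat.one_le_pow _ _ hℓ
    have hn := rankCost_le hℓ
    calc weightCost ℓ (maxRank ℓ) ≤
          2 ^ 6 * 2 ^ (ℓ + 14) * 2 ^ ((49 + 6) * ℓ) * (2 ^ (78 * ℓ)) ^ 5 := by
          rw [weightCost]
          gcongr
          · norm_num
          · exact Nat.lt_two_pow_self.le
          · exact le_trans (by omega) (mul_pow_le_two_pow (a := 49) (b := 6) hℓ)
      _ = 2 ^ (446 * ℓ + 20) := by rw [← pow_mul, ← pow_add, ← pow_add, ← pow_add]; ring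
      _ ≤ _ := Nat.pow_le_pow_right two_pos (by omega)
  have h2 : ℓ ≤ ℓ ^ 2 := Nat.le_self_pow two_ne_zero _
  calc maxWeight ℓ ≤ 2 ^ 4 * (2 ^ (466 * ℓ)) ^ (15 * ℓ) * 2 ^ (78 * ℓ) := by
        rw [maxWeight]
        gcongr
        norm_num
    _ = 2 ^ (6990 * ℓ ^ 2 + 78 * ℓ + 4) := by rw [← pow_mul, ← pow_add, ← pow_add]; ring
    _ ≤ _ := Nat.pow_le_pow_right two_pos (by omega)

theorem two_pow_mul_maxWeight_pow_le {ℓ : ℕ} (hℓ : 1 ≤ ℓ) :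
    2 ^ (ℓ + 14) * ((4 * maxWeight ℓ + 1) ^ 2) ^ maxRank ℓ ≤ 2 ^ (2 ^ 66 * ℓ ^ 12) := by
  have h2 : 1 ≤ ℓ ^ 2 := Nat.one_le_pow _ _ hℓ
  have h9 : ℓ ≤ ℓ ^ 9 := Nat.le_self_pow (by norm_num) _
  have h12 : ℓ ^ 9 ≤ ℓ ^ 12 := Nat.pow_le_pow_right hℓ (by norm_num)
  have hJ : 4 * maxWeight ℓ + 1 ≤ 2 ^ (7075 * ℓ ^ 2) := by
    have h := maxWeight_le hℓ
    have h1 : 1 ≤ 2 ^ (7072 * ℓ ^ 2) := Nat.one_le_two_pow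
    calc 4 * maxWeight ℓ + 1 ≤ 2 ^ (7072 * ℓ ^ 2 + 3) := by rw [pow_add]; omega
      _ ≤ _ := Nat.pow_le_pow_right two_pos (by omega)
  calc 2 ^ (ℓ + 14) * ((4 * maxWeight ℓ + 1) ^ 2) ^ maxRank ℓ
      ≤ 2 ^ (ℓ + 14) * ((2 ^ (7075 * ℓ ^ 2)) ^ 2) ^ (2 ^ 52 * ℓ ^ 7) := by
        gcongr
        · exact Nat.one_le_pow _ _ (by positivity)
        · exact maxRank_le hℓ
    _ = 2 ^ (14150 * 2 ^ 52 * ℓ ^ 9 + ℓ + 14) := by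
        rw [← pow_mul, ← pow_mul, ← pow_add]; ring
    _ ≤ _ := Nat.pow_le_pow_right two_pos (by omega)

end Iteration

section Density
variable [AddCommGroup G] [Fintype G]

theorem natCard_eq_expect_colAvg (A : Set (G × G)) :
    (Nat.card A : ℝ) = (𝔼 x, colAvg A Finset.univ x) * (Fintype.card G : ℝ) ^ 2 := by
  have hN : (Fintype.card G : ℝ) ≠ 0 := by exact_mod_cast Fintype.card_ne_zero
  simp only [colAvg, Finset.expect_eq_sum_div_card, Finset.card_univ]
  rw [← Finset.sum_div, ← Fintype.sum_prod_type' (fun x v => if (x, v) ∈ A then (1 : ℝ) else 0),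
    Finset.sum_boole, Nat.card_eq_fintype_card, Fintype.card_subtype]
  field_simp

theorem IsSkewCornerFree.colAvg_le_half {A : Set (G × G)} (hA : IsSkewCornerFree A) {x x' y' : G}
    (hx : x' ≠ x) (h : (x', y') ∈ A) : colAvg A Finset.univ x ≤ 1 / 2 := by
  have h1 : 𝔼 v, (if (x, v + (x' - x)) ∈ A then (1 : ℝ) else 0) = colAvg A Finset.univ x :=
    Fintype.expect_equiv (Equiv.addRight (x' - x)) _ _ fun _ => rfl
  have h2 : colAvg A Finset.univ x + colAvg A Finset.univ x ≤ 1 := by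
    nth_rw 2 [← h1]
    rw [colAvg, ← Finset.expect_add_distrib]
    refine Finset.expect_le Finset.univ_nonempty fun v _ => ?_
    split_ifs with ha hb
    · exact absurd (hA x v y' (x' - x) ha hb (by simpa using h)) (sub_ne_zero.2 hx)
    all_goals norm_num
  linarith

theorem IsSkewCornerFree.expect_colAvg_le_half {A : Set (G × G)} (hA : IsSkewCornerFree A)
    (hG : 2 ≤ Fintype.card G) : 𝔼 x, colAvg A Finset.univ x ≤ 1 / 2 := by
  by_cases hx : ∃ x, ∀ x' y', x' ≠ x → (x', y') ∉ A
  · obtain ⟨x, hx⟩ := hx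
    rw [Finset.expect_eq_sum_div_card, Finset.sum_eq_single x (fun x' _ hx' => by
      simp [colAvg, fun y' => hx x' y' hx']) (by simp), Finset.card_univ]
    exact div_le_div₀ zero_le_one (colAvg_le_one _ _ _) two_pos (by exact_mod_cast hG)
  · push Not at hx
    refine Finset.expect_le Finset.univ_nonempty fun x _ => ?_
    obtain ⟨x', y', hx', h⟩ := hx x
    exact hA.colAvg_le_half hx' h

theorem IsSkewCornerFree.log_card_rpow_le {A : Set (G × G)} (hA : IsSkewCornerFree A) {L : ℝ}
    (hL : Real.log 2 ≤ L) (hα : 𝔼 x, colAvg A Finset.univ x = Real.exp (-L)) :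
    Real.log (Fintype.card G) ^ (1 / 12 : ℝ) ≤ 384 * L := by
  have hl0 : 0 < Real.log 2 := Real.log_pos one_lt_two
  have hL0 : 0 < L := hl0.trans_le hL
  have hl : 1 / 2 ≤ Real.log 2 := by linarith [Real.log_two_gt_d9]
  have hl1 : Real.log 2 ≤ 1 := by linarith [Real.log_two_lt_d9]
  set ℓ := ⌈2 * L / Real.log 2⌉₊ with hℓ
  have h1 : 2 * L ≤ ℓ * Real.log 2 := (div_le_iff₀ hl0).1 (Nat.le_ceil _)
  have h2 : (ℓ : ℝ) * Real.log 2 ≤ 3 * L := by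
    have h : (ℓ : ℝ) < 2 * L / Real.log 2 + 1 := Nat.ceil_lt_add_one (by positivity)
    have := mul_le_mul_of_nonneg_right h.le hl0.le
    rw [add_mul, div_mul_cancel₀ _ hl0.ne'] at this
    linarith
  have hℓ1 : 1 ≤ ℓ := Nat.one_le_ceil_iff.2 (by positivity)
  have hcard := hA.card_lt hℓ1 (by
    rw [hα, ← Real.exp_nat_mul, one_div, inv_pow, ← Real.exp_log (pow_pos two_pos ℓ),
      ← Real.exp_neg, Real.log_pow]
    refine Real.exp_le_exp.2 ?_
    push_cast
    linarith)
  have hlog : Real.log (Fintype.card G) ≤ (64 * ℓ : ℝ) ^ 12 := by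
    have h3 : (Fintype.card G : ℝ) ≤ 2 ^ (2 ^ 66 * ℓ ^ 12) := by
      exact_mod_cast hcard.le.trans (two_pow_mul_maxWeight_pow_le hℓ1)
    refine (Real.log_le_log (by exact_mod_cast Fintype.card_pos) h3).trans ?_
    rw [Real.log_pow]
    have h4 : (0 : ℝ) ≤ (ℓ : ℝ) ^ 12 := by positivity
    calc ((2 ^ 66 * ℓ ^ 12 : ℕ) : ℝ) * Real.log 2 ≤ (2 ^ 66 * ℓ ^ 12 : ℕ) * 1 := by gcongr
      _ ≤ (64 * ℓ : ℝ) ^ 12 := by push_cast; rw [mul_pow]; linarith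
  have h5 : Real.log (Fintype.card G) ^ (1 / 12 : ℝ) ≤ 64 * ℓ := by
    calc Real.log (Fintype.card G) ^ (1 / 12 : ℝ) ≤ ((64 * ℓ : ℝ) ^ 12) ^ (1 / 12 : ℝ) :=
          Real.rpow_le_rpow (Real.log_natCast_nonneg _) hlog (by norm_num)
      _ = 64 * ℓ := by
          rw [← Real.rpow_natCast, ← Real.rpow_mul (by positivity)]
          norm_num
  nlinarith [(Nat.cast_nonneg ℓ : (0 : ℝ) ≤ ℓ)]

end Density

theorem statement2 :
    ∃ c : ℝ, 0 < c ∧ ∀ (G : Type) [AddCommGroup G] [Fintype G], 2 ≤ Fintype.card G →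
      ∀ A : Set (G × G), IsSkewCornerFree A →
      (Nat.card A : ℝ) ≤
        Real.exp (-c * Real.log (Fintype.card G) ^ ((1 : ℝ) / 12)) * (Fintype.card G : ℝ) ^ 2 := by
  refine ⟨1 / 384, by norm_num, fun G _ _ hG A hA => ?_⟩
  rw [natCard_eq_expect_colAvg]
  refine mul_le_mul_of_nonneg_right ?_ (by positivity)
  rcases (Finset.expect_nonneg fun x _ => colAvg_nonneg A Finset.univ x :
    0 ≤ 𝔼 x, colAvg A Finset.univ x).eq_or_lt with h | h
  · rw [← h]; positivity
  · obtain ⟨L, hL⟩ : ∃ L, 𝔼 x, colAvg A Finset.univ x = Real.exp (-L) :=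
      ⟨-Real.log (𝔼 x, colAvg A Finset.univ x), by rw [neg_neg, Real.exp_log h]⟩
    have hL2 : Real.log 2 ≤ L := by
      have h1 := hA.expect_colAvg_le_half hG
      rw [hL, ← Real.le_log_iff_exp_le (by norm_num), one_div, Real.log_inv] at h1
      linarith
    rw [hL]
    refine Real.exp_le_exp.2 ?_
    linarith [hA.log_card_rpow_le hL2 hL]

end SkewPaper
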